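/- Let ℋ be a hereditary property of simple ordered graphs whose closure cl(ℋ) is nonempty. Then the function W ↦ d₁(W, cl(ℋ)) is concave on the space of orderons: for all orderons W₁, W₂ and all λ ∈ [0,1], d₁(λW₁ + (1−λ)W₂, cl(ℋ)) ≥ λ·d₁(W₁, cl(ℋ)) + (1−λ)·d₁(W₂, cl(ℋ)). -/

import Mathlib

open MeasureTheory Real Filter
open scoped ENNReal Classical

noncomputable section

/-- The unit interval `[0,1]` as a subtype of `ℝ`. -/
abbrev UI : Type := Set.Icc (0:ℝ) 1

/-- The unit square `[0,1]²`. -/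
abbrev USq : Type := UI × UI

/-- An orderon: a symmetric measurable function `([0,1]²)² → [0,1]`. -/
def IsOrderon (W : USq → USq → ℝ) : Prop :=
  Measurable (Function.uncurry W) ∧ (∀ u v, W u v ∈ Set.Icc (0:ℝ) 1) ∧
    ∀ u v, W u v = W v u

/-- The (unordered) cut norm: `sup_{S,T} |∫_{S×T} W|` over measurable `S,T ⊆ [0,1]²`. -/
def cutNorm (W : USq → USq → ℝ) : ℝ :=
  sSup {x | ∃ S T : Set USq, MeasurableSet S ∧ MeasurableSet T ∧
    x = |∫ p in S ×ˢ T, W p.1 p.2|}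

/-- A measure-preserving bijection of `[0,1]²` with measure-preserving inverse. -/
def IsMPB (f : USq → USq) : Prop :=
  MeasurePreserving f volume volume ∧
  ∃ g : USq → USq, MeasurePreserving g volume volume ∧
    Function.LeftInverse g f ∧ Function.RightInverse g f

/-- `Shift(f) = sup_{(x,a)} |x - π₁(f(x,a))|`. -/
def shiftOf (f : USq → USq) : ℝ := ⨆ u : USq, |(u.1 : ℝ) - ((f u).1 : ℝ)|

/-- The cut-shift distance `d△(W,U) = inf_f (Shift(f) + ‖W - U^f‖_□)`. -/
def csDist (W U : USq → USq → ℝ) : ℝ :=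
  sInf {x | ∃ f : USq → USq, IsMPB f ∧
    x = shiftOf f + cutNorm (fun u v => W u v - U (f u) (f v))}

/-- `Q_n(z) = ⌈nz⌉` for `z ∈ (0,1]`, and `Q_n(0) = 1`. -/
def Qn (n : ℕ) (x : ℝ) : ℕ := max 1 ⌈(n : ℝ) * x⌉₊

/-- The naive `n`-block orderon of a weighted ordered graph `G : [n]² → [0,1]`
(given as a function `ℕ → ℕ → ℝ`, 1-indexed). -/
def blockOrderon (n : ℕ) (G : ℕ → ℕ → ℝ) : USq → USq → ℝ :=
  fun u v => G (Qn n (u.1 : ℝ)) (Qn n (v.1 : ℝ))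

/-- The (1-indexed, real-valued) adjacency function of a simple ordered graph on `[n]`. -/
def graphAdjFun {n : ℕ} (G : SimpleGraph (Fin n)) : ℕ → ℕ → ℝ :=
  fun i j => if h : i - 1 < n ∧ j - 1 < n then
    (if G.Adj ⟨i - 1, h.1⟩ ⟨j - 1, h.2⟩ then 1 else 0) else 0

/-- The naive block orderon `W_G` representing a simple ordered graph `G` on `[n]`. -/
def graphOrderon {n : ℕ} (G : SimpleGraph (Fin n)) : USq → USq → ℝ :=
  blockOrderon n (graphAdjFun G)

/-- The induced ordered subgraph of `G` on a `k`-element subset `S` of its vertices,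
with the vertices of `S` relabeled by `[k]` in increasing order. -/
def inducedSG {n : ℕ} (G : SimpleGraph (Fin n)) (k : ℕ) (S : Finset (Fin n)) :
    SimpleGraph (Fin k) :=
  if h : S.card = k then G.comap (fun i => (S.orderIsoOfFin h i : Fin n)) else ⊥

/-- A property of simple ordered graphs (one set of graphs for each number of
vertices) is hereditary if it is closed under taking induced ordered subgraphs. -/
def Hereditary (H : ∀ n, Set (SimpleGraph (Fin n))) : Prop :=
  ∀ (n k : ℕ) (G : SimpleGraph (Fin n)), G ∈ H n → ∀ S : Finset (Fin n), S.card = k →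
    inducedSG G k S ∈ H k

/-- Normalized edit (Hamming) distance between two ordered graphs on `[n]`:
`|{(i,j) : G(i,j) ≠ G'(i,j)}| / n²`. -/
def editDist {n : ℕ} (G G' : SimpleGraph (Fin n)) : ℝ :=
  ((Finset.univ.filter
      (fun p : Fin n × Fin n => ¬ (G.Adj p.1 p.2 ↔ G'.Adj p.1 p.2))).card : ℝ) / (n^2 : ℝ)

/-- Distance of `G` from a set of ordered graphs on the same vertex set. -/
def distToProp {n : ℕ} (G : SimpleGraph (Fin n)) (P : Set (SimpleGraph (Fin n))) : ℝ :=
  sInf {x | ∃ G' ∈ P, x = editDist G G'}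

/-- The `L¹` distance between two kernels on `([0,1]²)²`. -/
def d1 (W U : USq → USq → ℝ) : ℝ := ∫ p : USq × USq, |W p.1 p.2 - U p.1 p.2|

/-- `W` belongs to the closure `cl(ℋ)`: `W` is an orderon and there is a sequence of
graphs `Gₙ ∈ ℋ` with `|V(Gₙ)| → ∞` and `d△(W_{Gₙ}, W) → 0`. -/
def InClosure (H : ∀ n, Set (SimpleGraph (Fin n))) (W : USq → USq → ℝ) : Prop :=
  IsOrderon W ∧ ∃ (m : ℕ → ℕ) (G : ∀ n : ℕ, SimpleGraph (Fin (m n))),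
    (∀ n, G n ∈ H (m n)) ∧ Tendsto m atTop atTop ∧
    Tendsto (fun n => csDist (graphOrderon (G n)) W) atTop (nhds 0)

/-- `d₁(W, cl(ℋ)) = inf_{U ∈ cl(ℋ)} d₁(W,U)`. -/
def d1ToClosure (H : ∀ n, Set (SimpleGraph (Fin n))) (W : USq → USq → ℝ) : ℝ :=
  sInf {x | ∃ U : USq → USq → ℝ, InClosure H U ∧ x = d1 W U}

/-! ### Equipartitions of the unit interval -/

/-- The point of `[0,1]` at relative position `s` in the `a`-th of `m` equal blocks. -/
def blockPt (m : ℕ) [NeZero m] (a : Fin m) (s : UI) : UI :=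
  ⟨((a : ℝ) + s) / m, by
    have hm : (0 : ℝ) < m := by exact_mod_cast Nat.pos_of_ne_zero (NeZero.ne m)
    have ha : ((a : ℕ) : ℝ) + 1 ≤ m := by exact_mod_cast a.2
    have h0 := s.2.1
    have h1 := s.2.2
    refine ⟨by positivity, ?_⟩
    rw [div_le_one hm]
    linarith⟩

/-- The index of the block of `[0,1]` containing `x`, for `m` equal left-open blocks. -/
def blockIdx (m : ℕ) [NeZero m] (x : UI) : Fin m :=
  ⟨⌈(m : ℝ) * x⌉₊ - 1, by
    have hm : 0 < m := Nat.pos_of_ne_zero (NeZero.ne m)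
    have : ⌈(m : ℝ) * x⌉₊ ≤ m := by
      rw [Nat.ceil_le]
      exact mul_le_of_le_one_right (by positivity) x.2.2
    omega⟩

theorem blockIdx_le_mul (m : ℕ) [NeZero m] (x : UI) :
    ((blockIdx m x : ℕ) : ℝ) ≤ m * x ∧ (m : ℝ) * x ≤ (blockIdx m x : ℕ) + 1 := by
  have h0 : 0 ≤ (m : ℝ) * x := mul_nonneg (by positivity) x.2.1
  have h1 := Nat.le_ceil ((m : ℝ) * x)
  have h2 := Nat.ceil_lt_add_one h0
  simp only [blockIdx]
  rcases Nat.eq_zero_or_pos ⌈(m : ℝ) * x⌉₊ with h | h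
  · rw [h] at h1 ⊢
    norm_num at h1 ⊢
    exact ⟨h0, by linarith⟩
  · rw [Nat.cast_sub h]
    constructor <;> push_cast <;> linarith

theorem blockIdx_lt_mul (m : ℕ) [NeZero m] (x : UI) (hx : 0 < (x : ℝ)) :
    ((blockIdx m x : ℕ) : ℝ) < m * x := by
  have hm : (0 : ℝ) < m := by exact_mod_cast Nat.pos_of_ne_zero (NeZero.ne m)
  have h0 : 0 < (m : ℝ) * x := mul_pos hm hx
  have h2 := Nat.ceil_lt_add_one h0.le
  have h : 0 < ⌈(m : ℝ) * x⌉₊ := Nat.ceil_pos.2 h0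
  simp only [blockIdx]
  rw [Nat.cast_sub h]
  push_cast
  linarith

/-- The relative position of `x` in its block. -/
def blockFrac (m : ℕ) [NeZero m] (x : UI) : UI :=
  ⟨m * x - (blockIdx m x : ℕ), by
    have := blockIdx_le_mul m x
    constructor <;> linarith⟩

theorem blockPt_idx_frac (m : ℕ) [NeZero m] (x : UI) :
    blockPt m (blockIdx m x) (blockFrac m x) = x := by
  have hm : (m : ℝ) ≠ 0 := by exact_mod_cast NeZero.ne m
  ext
  simp only [blockPt, blockFrac]
  field_simp
  ring

theorem blockIdx_blockPt (m : ℕ) [NeZero m] (a : Fin m) (s : UI) (hs : 0 < (s : ℝ)) :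
    blockIdx m (blockPt m a s) = a := by
  have hm : (m : ℝ) ≠ 0 := by exact_mod_cast NeZero.ne m
  ext
  simp only [blockIdx, blockPt]
  have h1 := s.2.2
  have : ⌈(m : ℝ) * (((a : ℕ) + (s : ℝ)) / m)⌉₊ = (a : ℕ) + 1 := by
    rw [mul_div_cancel₀ _ hm, Nat.ceil_eq_iff (by simp)]
    push_cast
    constructor
    · simpa using hs
    · linarith
  rw [this]
  simp

theorem blockFrac_blockPt (m : ℕ) [NeZero m] (a : Fin m) (s : UI) (hs : 0 < (s : ℝ)) :
    blockFrac m (blockPt m a s) = s := by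
  have hm : (m : ℝ) ≠ 0 := by exact_mod_cast NeZero.ne m
  ext
  simp only [blockFrac]
  rw [blockIdx_blockPt m a s hs]
  simp only [blockPt]
  field_simp
  ring

theorem blockFrac_pos (m : ℕ) [NeZero m] (x : UI) (hx : 0 < (x : ℝ)) :
    0 < (blockFrac m x : ℝ) := by
  have := blockIdx_lt_mul m x hx
  simp only [blockFrac]
  linarith

theorem blockPt_pos (m : ℕ) [NeZero m] (a : Fin m) (s : UI) (hs : 0 < (s : ℝ)) :
    0 < (blockPt m a s : ℝ) := by
  have hm : (0 : ℝ) < m := by exact_mod_cast Nat.pos_of_ne_zero (NeZero.ne m)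
  simp only [blockPt]
  positivity

theorem measurable_blockPt (m : ℕ) [NeZero m] :
    Measurable (fun q : Fin m × UI => blockPt m q.1 q.2) := by
  refine Measurable.subtype_mk ?_
  refine Measurable.div_const (Measurable.add ?_ (by fun_prop)) _
  exact (measurable_from_top (f := fun a : Fin m => ((a : ℕ) : ℝ))).comp measurable_fst

theorem measurable_blockIdx (m : ℕ) [NeZero m] : Measurable (blockIdx m) := by
  refine measurable_to_countable' fun a => ?_
  have h : Measurable (fun x : UI => ⌈(m : ℝ) * x⌉₊ - 1) :=
    (measurable_from_top (f := fun k : ℕ => k - 1)).comp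
      (Nat.measurable_ceil.comp (by fun_prop))
  have : blockIdx m ⁻¹' {a} = (fun x : UI => ⌈(m : ℝ) * x⌉₊ - 1) ⁻¹' {(a : ℕ)} := by
    ext x
    simp [blockIdx, Fin.ext_iff]
  rw [this]
  exact h (measurableSet_singleton _)

theorem measurable_blockFrac (m : ℕ) [NeZero m] : Measurable (blockFrac m) := by
  refine Measurable.subtype_mk ?_
  refine Measurable.sub (by fun_prop) ?_
  exact (measurable_from_top (f := fun a : Fin m => ((a : ℕ) : ℝ))).comp (measurable_blockIdx m)

/-- The uniform probability measure on `Fin m`. -/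
def finUnif (m : ℕ) : Measure (Fin m) := (m : ℝ≥0∞)⁻¹ • Measure.count

instance (m : ℕ) [NeZero m] : IsProbabilityMeasure (finUnif m) := by
  constructor
  have hm : (m : ℝ≥0∞) ≠ 0 := by exact_mod_cast NeZero.ne m
  simp only [finUnif, Measure.smul_apply, smul_eq_mul, Measure.count_univ]
  simp only [ENat.card_eq_coe_fintype_card, Fintype.card_fin, ENat.toENNReal_coe]
  exact ENNReal.inv_mul_cancel hm (by simp)

theorem sum_clamp_sub (y : ℝ) (hy : 0 ≤ y) (k : ℕ) :
    ∑ a ∈ Finset.range k, max 0 (min 1 (y - a)) = min y k := by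
  induction k with
  | zero => simp [hy]
  | succ k ih =>
    rw [Finset.sum_range_succ, ih]
    push_cast
    rcases le_total y k with h | h
    · rw [min_eq_left h, min_eq_left (show y ≤ (k : ℝ) + 1 by linarith), max_eq_left, add_zero]
      exact (min_le_right _ _).trans (by linarith)
    · rw [min_eq_right h]
      rcases le_total y (k + 1) with h' | h'
      · rw [min_eq_left h', min_eq_right (by linarith), max_eq_right (by linarith)]
        ring
      · rw [min_eq_right h', min_eq_left (by linarith), max_eq_right (by linarith)]

theorem volume_blockPt_le (m : ℕ) [NeZero m] (a : Fin m) (x : UI) :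
    volume {s : UI | blockPt m a s ≤ x} = ENNReal.ofReal (max 0 (min 1 (m * x - (a : ℕ)))) := by
  have hm : (0 : ℝ) < m := by exact_mod_cast Nat.pos_of_ne_zero (NeZero.ne m)
  have key : ∀ s : UI, blockPt m a s ≤ x ↔ (s : ℝ) ≤ m * x - (a : ℕ) := by
    intro s
    rw [← Subtype.coe_le_coe]
    simp only [blockPt]
    rw [div_le_iff₀ hm]
    constructor <;> intro h <;> linarith
  rcases lt_or_ge ((m : ℝ) * x - (a : ℕ)) 0 with h | h
  · have : {s : UI | blockPt m a s ≤ x} = ∅ := by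
      ext s
      simp only [Set.mem_ofPred_eq, key, Set.mem_empty_iff_false, iff_false, not_le]
      exact lt_of_lt_of_le h s.2.1
    rw [this, max_eq_left ((min_le_right _ _).trans h.le)]
    simp
  · have : {s : UI | blockPt m a s ≤ x} =
        Set.Iic (⟨min 1 (m * x - (a : ℕ)), le_min zero_le_one h, min_le_left _ _⟩ : UI) := by
      ext s
      simp only [Set.mem_ofPred_eq, key, Set.mem_Iic]
      rw [← Subtype.coe_le_coe]
      simp [s.2.2]
    rw [this, max_eq_right (le_min zero_le_one h)]
    exact unitInterval.volume_Iic _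

theorem measurePreserving_blockPt (m : ℕ) [NeZero m] :
    MeasurePreserving (fun q : Fin m × UI => blockPt m q.1 q.2)
      ((finUnif m).prod volume) volume := by
  refine ⟨measurable_blockPt m, ?_⟩
  have hp : IsProbabilityMeasure (Measure.map (fun q : Fin m × UI => blockPt m q.1 q.2)
      ((finUnif m).prod volume)) :=
    Measure.isProbabilityMeasure_map (measurable_blockPt m).aemeasurable
  refine Measure.ext_of_Iic _ _ fun x => ?_
  have hm : (0 : ℝ) < m := by exact_mod_cast Nat.pos_of_ne_zero (NeZero.ne m)
  rw [Measure.map_apply (measurable_blockPt m) measurableSet_Iic,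
    Measure.prod_apply ((measurable_blockPt m) measurableSet_Iic)]
  have : ∀ a : Fin m, volume (Prod.mk a ⁻¹' ((fun q : Fin m × UI => blockPt m q.1 q.2) ⁻¹'
      Set.Iic x)) = ENNReal.ofReal (max 0 (min 1 (m * x - (a : ℕ)))) :=
    fun a => volume_blockPt_le m a x
  simp only [this]
  rw [finUnif, lintegral_smul_measure, lintegral_count, tsum_fintype,
    ← ENNReal.ofReal_sum_of_nonneg (fun _ _ => le_max_left _ _),
    Fin.sum_univ_eq_sum_range (fun a => max 0 (min 1 ((m : ℝ) * x - a))),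
    sum_clamp_sub _ (mul_nonneg hm.le x.2.1),
    min_eq_left (mul_le_of_le_one_right hm.le x.2.2)]
  have h2 : volume (Set.Iic x) = ENNReal.ofReal (x : ℝ) := unitInterval.volume_Iic x
  rw [h2, ENNReal.ofReal_mul hm.le, ENNReal.ofReal_natCast, smul_eq_mul, ← mul_assoc,
    ENNReal.inv_mul_cancel (by exact_mod_cast NeZero.ne m) (by simp), one_mul]

theorem ae_pos_UI : ∀ᵐ x : UI, 0 < (x : ℝ) := by
  have h : (volume : Measure UI) {0} = 0 :=
    measure_singleton (μ := (volume : Measure unitInterval)) 0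
  filter_upwards [compl_mem_ae_iff.2 h] with x hx
  exact lt_of_le_of_ne x.2.1 fun h => hx (by ext; exact h.symm)

theorem measurePreserving_blockSplit (m : ℕ) [NeZero m] :
    MeasurePreserving (fun x : UI => (blockIdx m x, blockFrac m x))
      volume ((finUnif m).prod volume) := by
  have hmeas : Measurable (fun x : UI => (blockIdx m x, blockFrac m x)) :=
    (measurable_blockIdx m).prodMk (measurable_blockFrac m)
  refine ⟨hmeas, ?_⟩
  conv_lhs => rw [← (measurePreserving_blockPt m).map_eq]
  rw [Measure.map_map hmeas (measurable_blockPt m)]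
  have : ((fun x : UI => (blockIdx m x, blockFrac m x)) ∘
      fun q : Fin m × UI => blockPt m q.1 q.2) =ᵐ[(finUnif m).prod volume] id := by
    have hs : ∀ᵐ q : Fin m × UI ∂((finUnif m).prod volume), 0 < (q.2 : ℝ) :=
      Measure.quasiMeasurePreserving_snd.ae ae_pos_UI
    filter_upwards [hs] with q hq
    simp [blockIdx_blockPt m _ _ hq, blockFrac_blockPt m _ _ hq]
  rw [Measure.map_congr this, Measure.map_id]

/-! ### Rearrangements of the unit square inside columns -/

theorem measurePreserving_prodLeftComm {α β γ : Type*} [MeasurableSpace α] [MeasurableSpace β]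
    [MeasurableSpace γ] (μ : Measure α) (ν : Measure β) (ρ : Measure γ) [SFinite μ] [SFinite ν]
    [SFinite ρ] :
    MeasurePreserving (fun q : α × β × γ => (q.2.1, q.1, q.2.2))
      (μ.prod (ν.prod ρ)) (ν.prod (μ.prod ρ)) := by
  have h1 := (measurePreserving_prodAssoc μ ν ρ).symm
  have h2 := (Measure.measurePreserving_swap (μ := μ) (ν := ν)).prod (MeasurePreserving.id ρ)
  have h3 := measurePreserving_prodAssoc ν μ ρ
  exact h3.comp (h2.comp h1)

theorem measurePreserving_perm_finUnif (m : ℕ) (σ : Equiv.Perm (Fin m)) :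
    MeasurePreserving σ (finUnif m) (finUnif m) := by
  have hσ : Measurable (σ : Fin m → Fin m) := measurable_from_top
  refine ⟨hσ, Measure.ext_of_singleton fun a => ?_⟩
  rw [Measure.map_apply hσ (measurableSet_singleton _)]
  have : (σ : Fin m → Fin m) ⁻¹' {a} = {σ.symm a} := by
    ext b
    simp [Equiv.eq_symm_apply]
  rw [this]
  simp [finUnif]

theorem measurePreserving_columnwise (m : ℕ) [NeZero m] (g : Fin m → USq → USq)
    (hg : ∀ a, MeasurePreserving (g a) volume volume) :
    MeasurePreserving (fun u : USq =>
      (blockPt m (blockIdx m u.1) (g (blockIdx m u.1) (blockFrac m u.1, u.2)).1,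
        (g (blockIdx m u.1) (blockFrac m u.1, u.2)).2)) volume volume := by
  have h1 := (measurePreserving_blockSplit m).prod (MeasurePreserving.id (volume : Measure UI))
  have h2 := measurePreserving_prodAssoc (finUnif m) (volume : Measure UI) (volume : Measure UI)
  have h3 := (MeasurePreserving.id (finUnif m)).skew_product (g := g)
    (measurable_from_prod_countable_right fun a => (hg a).measurable)
    (Filter.Eventually.of_forall fun a => (hg a).map_eq)
  have h4 := h2.symm
  have h5 := (measurePreserving_blockPt m).prod (MeasurePreserving.id (volume : Measure UI))
  exact h5.comp (h4.comp (h3.comp (h2.comp h1)))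

/-- Move the `b`-th vertical strip of the `a`-th column onto the `σ a b`-th box of that column. -/
def rearrangeAux (m : ℕ) [NeZero m] (σ : Fin m → Equiv.Perm (Fin m)) (u : USq) : USq :=
  (blockPt m (blockIdx m u.1) (blockFrac m (blockFrac m u.1)),
    blockPt m (σ (blockIdx m u.1) (blockIdx m (blockFrac m u.1))) u.2)

/-- The inverse of `rearrangeAux` away from the left and bottom sides. -/
def rearrangeInvAux (m : ℕ) [NeZero m] (σ : Fin m → Equiv.Perm (Fin m)) (u : USq) : USq :=
  (blockPt m (blockIdx m u.1)
    (blockPt m ((σ (blockIdx m u.1)).symm (blockIdx m u.2)) (blockFrac m u.1)), blockFrac m u.2)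

theorem measurePreserving_rearrangeAux (m : ℕ) [NeZero m] (σ : Fin m → Equiv.Perm (Fin m)) :
    MeasurePreserving (rearrangeAux m σ) volume volume := by
  refine measurePreserving_columnwise m
    (fun a w => (blockFrac m w.1, blockPt m (σ a (blockIdx m w.1)) w.2)) fun a => ?_
  have h1 := (measurePreserving_blockSplit m).prod (MeasurePreserving.id (volume : Measure UI))
  have h2 := measurePreserving_prodAssoc (finUnif m) (volume : Measure UI) (volume : Measure UI)
  have h3 := measurePreserving_prodLeftComm (finUnif m) (volume : Measure UI)
    (volume : Measure UI)
  have h4 := (MeasurePreserving.id (volume : Measure UI)).prod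
    ((measurePreserving_perm_finUnif m (σ a)).prod (MeasurePreserving.id (volume : Measure UI)))
  have h5 := (MeasurePreserving.id (volume : Measure UI)).prod (measurePreserving_blockPt m)
  exact h5.comp (h4.comp (h3.comp (h2.comp h1)))

theorem measurePreserving_rearrangeInvAux (m : ℕ) [NeZero m] (σ : Fin m → Equiv.Perm (Fin m)) :
    MeasurePreserving (rearrangeInvAux m σ) volume volume := by
  refine measurePreserving_columnwise m
    (fun a w => (blockPt m ((σ a).symm (blockIdx m w.2)) w.1, blockFrac m w.2)) fun a => ?_
  have h1 := (MeasurePreserving.id (volume : Measure UI)).prod (measurePreserving_blockSplit m)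
  have h2 := measurePreserving_prodLeftComm (volume : Measure UI) (finUnif m)
    (volume : Measure UI)
  have h3 := (measurePreserving_prodAssoc (finUnif m) (volume : Measure UI)
    (volume : Measure UI)).symm
  have h4 := ((measurePreserving_perm_finUnif m (σ a).symm).prod
    (MeasurePreserving.id (volume : Measure UI))).prod (MeasurePreserving.id (volume : Measure UI))
  have h5 := (measurePreserving_blockPt m).prod (MeasurePreserving.id (volume : Measure UI))
  exact h5.comp (h4.comp (h3.comp (h2.comp h1)))

/-- The bijection of the unit square moving the `b`-th vertical strip of the `a`-th column onto the
`σ a b`-th box of that column, and fixing the left and bottom sides. -/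
def rearrange (m : ℕ) [NeZero m] (σ : Fin m → Equiv.Perm (Fin m)) (u : USq) : USq :=
  if 0 < (u.1 : ℝ) ∧ 0 < (u.2 : ℝ) then rearrangeAux m σ u else u

/-- The inverse of `rearrange`. -/
def rearrangeInv (m : ℕ) [NeZero m] (σ : Fin m → Equiv.Perm (Fin m)) (u : USq) : USq :=
  if 0 < (u.1 : ℝ) ∧ 0 < (u.2 : ℝ) then rearrangeInvAux m σ u else u

theorem ae_pos_USq : ∀ᵐ u : USq, 0 < (u.1 : ℝ) ∧ 0 < (u.2 : ℝ) := by
  have h1 : ∀ᵐ u : USq, 0 < (u.1 : ℝ) := Measure.quasiMeasurePreserving_fst.ae ae_pos_UI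
  have h2 : ∀ᵐ u : USq, 0 < (u.2 : ℝ) := Measure.quasiMeasurePreserving_snd.ae ae_pos_UI
  exact h1.and h2

theorem measurePreserving_ite_pos {f : USq → USq} (hf : MeasurePreserving f volume volume) :
    MeasurePreserving (fun u : USq => if 0 < (u.1 : ℝ) ∧ 0 < (u.2 : ℝ) then f u else u)
      volume volume := by
  have h1 : Measurable (fun u : USq => (u.1 : ℝ)) := by fun_prop
  have h2 : Measurable (fun u : USq => (u.2 : ℝ)) := by fun_prop
  have hs : MeasurableSet {u : USq | 0 < (u.1 : ℝ) ∧ 0 < (u.2 : ℝ)} :=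
    (h1 measurableSet_Ioi).inter (h2 measurableSet_Ioi)
  refine ⟨Measurable.ite hs hf.measurable measurable_id, ?_⟩
  refine Eq.trans (Measure.map_congr ?_) hf.map_eq
  filter_upwards [ae_pos_USq] with u hu
  rw [if_pos hu]

theorem isMPB_rearrange (m : ℕ) [NeZero m] (σ : Fin m → Equiv.Perm (Fin m)) :
    IsMPB (rearrange m σ) := by
  refine ⟨measurePreserving_ite_pos (measurePreserving_rearrangeAux m σ), rearrangeInv m σ,
    measurePreserving_ite_pos (measurePreserving_rearrangeInvAux m σ), fun u => ?_, fun u => ?_⟩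
  · by_cases h : 0 < (u.1 : ℝ) ∧ 0 < (u.2 : ℝ)
    · have hs := blockFrac_pos m _ (blockFrac_pos m _ h.1)
      have h' : 0 < ((rearrangeAux m σ u).1 : ℝ) ∧ 0 < ((rearrangeAux m σ u).2 : ℝ) :=
        ⟨blockPt_pos m _ _ hs, blockPt_pos m _ _ h.2⟩
      rw [rearrange, if_pos h, rearrangeInv, if_pos h']
      simp only [rearrangeInvAux, rearrangeAux, blockIdx_blockPt m _ _ hs,
        blockIdx_blockPt m _ _ h.2, blockFrac_blockPt m _ _ hs, blockFrac_blockPt m _ _ h.2,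
        Equiv.symm_apply_apply, blockPt_idx_frac]
    · rw [rearrange, if_neg h, rearrangeInv, if_neg h]
  · by_cases h : 0 < (u.1 : ℝ) ∧ 0 < (u.2 : ℝ)
    · have hs := blockFrac_pos m _ h.1
      have hs2 := blockFrac_pos m _ h.2
      have hp := fun a => blockPt_pos m a _ hs
      have h' : 0 < ((rearrangeInvAux m σ u).1 : ℝ) ∧ 0 < ((rearrangeInvAux m σ u).2 : ℝ) :=
        ⟨blockPt_pos m _ _ (hp _), hs2⟩
      rw [rearrangeInv, if_pos h, rearrange, if_pos h']
      simp only [rearrangeInvAux, rearrangeAux, blockIdx_blockPt m _ _ (hp _),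
        blockIdx_blockPt m _ _ hs, blockFrac_blockPt m _ _ hs, blockFrac_blockPt m _ _ (hp _),
        Equiv.apply_symm_apply, blockPt_idx_frac]
    · rw [rearrangeInv, if_neg h, rearrange, if_neg h]

theorem abs_blockPt_sub_le (m : ℕ) [NeZero m] (a : Fin m) (s t : UI) :
    |(blockPt m a s : ℝ) - blockPt m a t| ≤ 1 / m := by
  have hm : (0 : ℝ) < m := by exact_mod_cast Nat.pos_of_ne_zero (NeZero.ne m)
  simp only [blockPt]
  rw [← sub_div, abs_div, abs_of_pos hm]
  gcongr
  rw [abs_le]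
  constructor <;> linarith [s.2.1, s.2.2, t.2.1, t.2.2]

theorem shiftOf_rearrange_le (m : ℕ) [NeZero m] (σ : Fin m → Equiv.Perm (Fin m)) :
    shiftOf (rearrange m σ) ≤ 1 / m := by
  refine ciSup_le fun u => ?_
  rw [rearrange]
  split_ifs
  · have h := abs_blockPt_sub_le m (blockIdx m u.1) (blockFrac m u.1)
      (blockFrac m (blockFrac m u.1))
    rwa [blockPt_idx_frac] at h
  · simp

/-! ### The cut norm, the shift and the cut-shift distance -/

theorem cutNorm_nonneg (D : USq → USq → ℝ) : 0 ≤ cutNorm D := by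
  refine Real.sSup_nonneg ?_
  rintro x ⟨S, T, -, -, rfl⟩
  exact abs_nonneg _

theorem cutNorm_le {D : USq → USq → ℝ} {c : ℝ} (hc : 0 ≤ c)
    (h : ∀ S T : Set USq, MeasurableSet S → MeasurableSet T →
      |∫ p in S ×ˢ T, D p.1 p.2| ≤ c) : cutNorm D ≤ c := by
  refine Real.sSup_le ?_ hc
  rintro x ⟨S, T, hS, hT, rfl⟩
  exact h S T hS hT

theorem cutNorm_neg (D : USq → USq → ℝ) : cutNorm (fun u v => -D u v) = cutNorm D := by
  simp only [cutNorm, integral_neg, abs_neg]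

theorem integrable_of_abs_le {α : Type*} [MeasurableSpace α] {μ : Measure α} [IsFiniteMeasure μ]
    {f : α → ℝ} (hf : Measurable f) {C : ℝ} (h : ∀ x, |f x| ≤ C) : Integrable f μ :=
  Integrable.of_bound hf.aestronglyMeasurable C (Filter.Eventually.of_forall h)

theorem abs_setIntegral_le_cutNorm {D : USq → USq → ℝ} (hb : ∀ u v, |D u v| ≤ 1) {S T : Set USq}
    (hS : MeasurableSet S) (hT : MeasurableSet T) :
    |∫ p in S ×ˢ T, D p.1 p.2| ≤ cutNorm D := by
  refine le_csSup ⟨1, ?_⟩ ⟨S, T, hS, hT, rfl⟩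
  rintro x ⟨S, T, hS, hT, rfl⟩
  have h := norm_setIntegral_le_of_norm_le_const (μ := (volume : Measure (USq × USq)))
    (s := S ×ˢ T) (f := fun p => D p.1 p.2) (C := 1) (measure_lt_top _ _)
    (fun p _ => hb p.1 p.2)
  refine h.trans ?_
  rw [one_mul]
  exact measureReal_le_one

theorem exists_integral_mul_le_indicator {K : USq → USq → ℝ}
    (hK : Measurable (Function.uncurry K)) (hb : ∀ u v, |K u v| ≤ 1) {a : USq → ℝ}
    (ha : Measurable a) (ha01 : ∀ u, a u ∈ Set.Icc (0 : ℝ) 1) :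
    ∃ S : Set USq, MeasurableSet S ∧
      ∫ p : USq × USq, a p.1 * K p.1 p.2 ≤ ∫ p : USq × USq, S.indicator 1 p.1 * K p.1 p.2 := by
  have hh : Measurable (fun u => ∫ v, K u v) :=
    (hK.stronglyMeasurable.integral_prod_right (ν := volume)).measurable
  have hhb : ∀ u, |∫ v, K u v| ≤ 1 := fun u => by
    have := norm_integral_le_of_norm_le_const (μ := (volume : Measure USq)) (f := fun v => K u v)
      (C := 1) (Filter.Eventually.of_forall (hb u))
    simpa using this
  have key : ∀ c : USq → ℝ, Measurable c → (∀ u, c u ∈ Set.Icc (0 : ℝ) 1) →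
      ∫ p : USq × USq, c p.1 * K p.1 p.2 = ∫ u, c u * ∫ v, K u v := by
    intro c hc hc01
    have hi : Integrable (fun p : USq × USq => c p.1 * K p.1 p.2) (volume.prod volume) := by
      refine integrable_of_abs_le (C := 1) ((hc.comp measurable_fst).mul hK) fun p => ?_
      rw [abs_mul, abs_of_nonneg (hc01 _).1]
      exact mul_le_one₀ (hc01 _).2 (abs_nonneg _) (hb _ _)
    rw [Measure.volume_eq_prod, integral_prod _ hi]
    simp only [integral_const_mul]
  refine ⟨{u | 0 < ∫ v, K u v}, hh measurableSet_Ioi, ?_⟩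
  have hS : MeasurableSet {u | 0 < ∫ v, K u v} := hh measurableSet_Ioi
  have hind : Measurable (Set.indicator {u | 0 < ∫ v, K u v} (1 : USq → ℝ)) :=
    measurable_one.indicator hS
  have hind01 : ∀ u, Set.indicator {u | 0 < ∫ v, K u v} (1 : USq → ℝ) u ∈ Set.Icc (0 : ℝ) 1 := by
    intro u
    by_cases h : u ∈ {u | 0 < ∫ v, K u v} <;> simp [Set.indicator, h]
  rw [key a ha ha01, key _ hind hind01]
  have hInt : ∀ c : USq → ℝ, Measurable c → (∀ u, c u ∈ Set.Icc (0 : ℝ) 1) →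
      Integrable (fun u => c u * ∫ v, K u v) := by
    intro c hc hc01
    refine integrable_of_abs_le (C := 1) (hc.mul hh) fun u => ?_
    rw [abs_mul, abs_of_nonneg (hc01 _).1]
    exact mul_le_one₀ (hc01 _).2 (abs_nonneg _) (hhb _)
  refine integral_mono (hInt a ha ha01) (hInt _ hind hind01) fun u => ?_
  by_cases h : 0 < ∫ v, K u v
  · simp only [Set.indicator, Set.mem_ofPred_eq, h, if_true, Pi.one_apply]
    exact mul_le_mul_of_nonneg_right (ha01 u).2 h.le
  · simp only [Set.indicator, Set.mem_ofPred_eq, h, if_false, zero_mul]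
    exact mul_nonpos_of_nonneg_of_nonpos (ha01 u).1 (not_lt.1 h)

theorem integral_mul_mul_le_cutNorm {D : USq → USq → ℝ} (hD : Measurable (Function.uncurry D))
    (hb : ∀ u v, |D u v| ≤ 1) {a b : USq → ℝ} (ha : Measurable a)
    (ha01 : ∀ u, a u ∈ Set.Icc (0 : ℝ) 1) (hbm : Measurable b)
    (hb01 : ∀ u, b u ∈ Set.Icc (0 : ℝ) 1) :
    ∫ p : USq × USq, a p.1 * b p.2 * D p.1 p.2 ≤ cutNorm D := by
  obtain ⟨S, hS, h1⟩ := exists_integral_mul_le_indicator (K := fun u v => b v * D u v)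
    ((hbm.comp measurable_snd).mul hD)
    (fun u v => by
      rw [abs_mul, abs_of_nonneg (hb01 _).1]
      exact mul_le_one₀ (hb01 _).2 (abs_nonneg _) (hb _ _)) ha ha01
  have hSm : Measurable (S.indicator (1 : USq → ℝ)) := measurable_one.indicator hS
  have hS01 : ∀ u, S.indicator (1 : USq → ℝ) u ∈ Set.Icc (0 : ℝ) 1 := by
    intro u
    by_cases h : u ∈ S <;> simp [Set.indicator, h]
  obtain ⟨T, hT, h2⟩ := exists_integral_mul_le_indicator
    (K := fun v u => S.indicator 1 u * D u v)
    ((hSm.comp measurable_snd).mul (hD.comp measurable_swap))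
    (fun u v => by
      rw [abs_mul, abs_of_nonneg (hS01 _).1]
      exact mul_le_one₀ (hS01 _).2 (abs_nonneg _) (hb _ _)) hbm hb01
  have hswap : ∀ f : USq × USq → ℝ, ∫ p : USq × USq, f p.swap = ∫ p, f p :=
    fun f => integral_prod_swap f
  have h3 : ∫ p : USq × USq, T.indicator 1 p.1 * (S.indicator 1 p.2 * D p.2 p.1) =
      ∫ p in S ×ˢ T, D p.1 p.2 := by
    rw [← integral_indicator (hS.prod hT),
      ← hswap fun p => T.indicator 1 p.1 * (S.indicator 1 p.2 * D p.2 p.1)]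
    congr 1
    ext p
    by_cases hp1 : p.1 ∈ S <;> by_cases hp2 : p.2 ∈ T <;>
      simp [Set.indicator, Set.mem_prod, hp1, hp2]
  calc ∫ p : USq × USq, a p.1 * b p.2 * D p.1 p.2
      = ∫ p : USq × USq, a p.1 * (b p.2 * D p.1 p.2) := by simp only [mul_assoc]
    _ ≤ _ := h1
    _ = ∫ p : USq × USq, b p.1 * (S.indicator 1 p.2 * D p.2 p.1) := by
        rw [← hswap fun p => b p.1 * (S.indicator 1 p.2 * D p.2 p.1)]
        congr 1
        ext p
        simp only [Prod.fst_swap, Prod.snd_swap]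
        ring
    _ ≤ _ := h2
    _ = _ := h3
    _ ≤ _ := (le_abs_self _).trans (abs_setIntegral_le_cutNorm hb hS hT)

theorem abs_integral_mul_mul_le_cutNorm {D : USq → USq → ℝ}
    (hD : Measurable (Function.uncurry D))
    (hb : ∀ u v, |D u v| ≤ 1) {a b : USq → ℝ} (ha : Measurable a)
    (ha01 : ∀ u, a u ∈ Set.Icc (0 : ℝ) 1) (hbm : Measurable b)
    (hb01 : ∀ u, b u ∈ Set.Icc (0 : ℝ) 1) :
    |∫ p : USq × USq, a p.1 * b p.2 * D p.1 p.2| ≤ cutNorm D := by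
  refine abs_le'.2 ⟨integral_mul_mul_le_cutNorm hD hb ha ha01 hbm hb01, ?_⟩
  have := integral_mul_mul_le_cutNorm (D := fun u v => -D u v) hD.neg
    (fun u v => by rw [abs_neg]; exact hb u v) ha ha01 hbm hb01
  rw [cutNorm_neg] at this
  simpa only [mul_neg, integral_neg] using this

theorem abs_UI_sub_le_one (x y : UI) : |(x : ℝ) - y| ≤ 1 := by
  rw [abs_le]
  constructor <;> linarith [x.2.1, x.2.2, y.2.1, y.2.2]

theorem abs_sub_le_shiftOf (f : USq → USq) (u : USq) :
    |(u.1 : ℝ) - ((f u).1 : ℝ)| ≤ shiftOf f := by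
  refine le_ciSup (f := fun u : USq => |(u.1 : ℝ) - ((f u).1 : ℝ)|) ⟨1, ?_⟩ u
  rintro x ⟨v, rfl⟩
  exact abs_UI_sub_le_one _ _

theorem shiftOf_nonneg (f : USq → USq) : 0 ≤ shiftOf f :=
  Real.iSup_nonneg fun _ => abs_nonneg _

theorem isMPB_id : IsMPB id :=
  ⟨MeasurePreserving.id _, id, MeasurePreserving.id _, fun _ => rfl, fun _ => rfl⟩

theorem zero_mem_lowerBounds_csDist (W U : USq → USq → ℝ) :
    0 ∈ lowerBounds {x | ∃ f : USq → USq, IsMPB f ∧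
      x = shiftOf f + cutNorm (fun u v => W u v - U (f u) (f v))} := by
  rintro x ⟨f, -, rfl⟩
  exact add_nonneg (shiftOf_nonneg f) (cutNorm_nonneg _)

theorem csDist_nonneg (W U : USq → USq → ℝ) : 0 ≤ csDist W U :=
  Real.sInf_nonneg fun _ hx => zero_mem_lowerBounds_csDist W U hx

theorem csDist_le (W U : USq → USq → ℝ) {f : USq → USq} (hf : IsMPB f) :
    csDist W U ≤ shiftOf f + cutNorm (fun u v => W u v - U (f u) (f v)) :=
  csInf_le ⟨0, zero_mem_lowerBounds_csDist W U⟩ ⟨f, hf, rfl⟩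

theorem exists_isMPB_of_csDist_lt {W U : USq → USq → ℝ} {c : ℝ} (h : csDist W U < c) :
    ∃ f : USq → USq, IsMPB f ∧ shiftOf f < c ∧
      cutNorm (fun u v => W u v - U (f u) (f v)) < c := by
  obtain ⟨x, ⟨f, hf, rfl⟩, hx⟩ := exists_lt_of_csInf_lt (by exact ⟨_, id, isMPB_id, rfl⟩) h
  exact ⟨f, hf, by linarith [cutNorm_nonneg (fun u v => W u v - U (f u) (f v))],
    by linarith [shiftOf_nonneg f]⟩

/-! ### The counting lemma -/

theorem measurePreserving_update_prod {ι α : Type*} [Fintype ι] [DecidableEq ι]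
    [MeasurableSpace α] (μ : ι → Measure α) [∀ i, IsProbabilityMeasure (μ i)] (i : ι) :
    MeasurePreserving (fun q : (ι → α) × α => Function.update q.1 i q.2)
      ((Measure.pi μ).prod (μ i)) (Measure.pi μ) := by
  have hm : Measurable (fun q : (ι → α) × α => Function.update q.1 i q.2) := by
    refine measurable_pi_iff.2 fun j => ?_
    by_cases h : j = i
    · subst h
      simpa using measurable_snd
    · simp only [Function.update_of_ne h]
      exact (measurable_pi_apply j).comp measurable_fst
  refine ⟨hm, (Measure.pi_eq fun s hs => ?_).symm⟩
  rw [Measure.map_apply hm (MeasurableSet.univ_pi hs)]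
  have : (fun q : (ι → α) × α => Function.update q.1 i q.2) ⁻¹' Set.univ.pi s =
      (Set.univ.pi (Function.update s i Set.univ)) ×ˢ s i := by
    ext q
    simp only [Set.mem_preimage, Set.mem_pi, Set.mem_univ, true_imp_iff, Set.mem_prod]
    constructor
    · intro h
      refine ⟨fun j => ?_, by simpa using h i⟩
      by_cases hj : j = i
      · subst hj; simp
      · simpa [Function.update_of_ne hj] using h j
    · rintro ⟨h1, h2⟩ j
      by_cases hj : j = i
      · subst hj; simpa using h2
      · simpa [Function.update_of_ne hj] using h1 j
  rw [this, Measure.prod_prod, Measure.pi_pi]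
  rw [← Finset.mul_prod_erase _ _ (Finset.mem_univ i),
    ← Finset.mul_prod_erase _ (fun j => μ j (s j)) (Finset.mem_univ i)]
  simp only [Function.update_self, measure_univ, one_mul]
  rw [mul_comm]
  congr 1
  refine Finset.prod_congr rfl fun j hj => ?_
  rw [Function.update_of_ne (Finset.ne_of_mem_erase hj)]

theorem measurePreserving_update_update {ι α : Type*} [Fintype ι] [DecidableEq ι]
    [MeasurableSpace α] (μ : ι → Measure α) [∀ i, IsProbabilityMeasure (μ i)] (i j : ι) :
    MeasurePreserving
      (fun q : (ι → α) × (α × α) => Function.update (Function.update q.1 i q.2.1) j q.2.2)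
      ((Measure.pi μ).prod ((μ i).prod (μ j))) (Measure.pi μ) := by
  have h1 := (measurePreserving_prodAssoc (Measure.pi μ) (μ i) (μ j)).symm
  have h2 := (measurePreserving_update_prod μ i).prod (MeasurePreserving.id (μ j))
  exact (measurePreserving_update_prod μ j).comp (h2.comp h1)

theorem measurable_kernel_eval {ι : Type*} {D : USq → USq → ℝ}
    (hD : Measurable (Function.uncurry D)) (i j : ι) :
    Measurable fun p : ι → USq => D (p i) (p j) := by
  have h : Measurable fun p : ι → USq => (p i, p j) :=
    (measurable_pi_apply i).prodMk (measurable_pi_apply j)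
  exact hD.comp h

theorem abs_integral_mul_le_cutNorm {ι : Type*} [Fintype ι] [DecidableEq ι] {i j : ι}
    (hij : i ≠ j) {A B : (ι → USq) → ℝ} (hA : Measurable A) (hB : Measurable B)
    (hA01 : ∀ p, A p ∈ Set.Icc (0 : ℝ) 1) (hB01 : ∀ p, B p ∈ Set.Icc (0 : ℝ) 1)
    (hAj : ∀ p v, A (Function.update p j v) = A p) (hBi : ∀ p u, B (Function.update p i u) = B p)
    {D : USq → USq → ℝ} (hD : Measurable (Function.uncurry D)) (hb : ∀ u v, |D u v| ≤ 1) :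
    |∫ p : ι → USq, A p * B p * D (p i) (p j)| ≤ cutNorm D := by
  have hMP := measurePreserving_update_update (fun _ : ι => (volume : Measure USq)) i j
  have hF : Measurable (fun p : ι → USq => A p * B p * D (p i) (p j)) :=
    (hA.mul hB).mul (measurable_kernel_eval hD i j)
  have h1 : ∫ p : ι → USq, A p * B p * D (p i) (p j) =
      ∫ q : (ι → USq) × (USq × USq), A (Function.update q.1 i q.2.1) *
        B (Function.update q.1 j q.2.2) * D q.2.1 q.2.2
        ∂((Measure.pi fun _ => volume).prod (volume.prod volume)) := by
    have h := integral_map (μ := (Measure.pi fun _ : ι => (volume : Measure USq)).prod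
      (volume.prod volume)) hMP.measurable.aemeasurable
      (f := fun p => A p * B p * D (p i) (p j)) hF.aestronglyMeasurable
    rw [hMP.map_eq] at h
    rw [volume_pi, h]
    refine integral_congr_ae (Filter.Eventually.of_forall fun q => ?_)
    simp only [Function.update_self, hAj]
    rw [Function.update_comm hij, hBi]
    simp
  have hG : Measurable (fun q : (ι → USq) × (USq × USq) => A (Function.update q.1 i q.2.1) *
      B (Function.update q.1 j q.2.2) * D q.2.1 q.2.2) := by
    have m1 := (measurePreserving_update_prod (fun _ : ι => (volume : Measure USq)) i).measurable
    have m2 := (measurePreserving_update_prod (fun _ : ι => (volume : Measure USq)) j).measurable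
    exact ((hA.comp (m1.comp (measurable_fst.prodMk (measurable_fst.comp measurable_snd)))).mul
      (hB.comp (m2.comp (measurable_fst.prodMk (measurable_snd.comp measurable_snd))))).mul
      (hD.comp measurable_snd)
  have hGi : Integrable (fun q : (ι → USq) × (USq × USq) => A (Function.update q.1 i q.2.1) *
      B (Function.update q.1 j q.2.2) * D q.2.1 q.2.2)
      ((Measure.pi fun _ => volume).prod (volume.prod volume)) := by
    refine integrable_of_abs_le (C := 1) hG fun q => ?_
    rw [abs_mul, abs_mul, abs_of_nonneg (hA01 _).1, abs_of_nonneg (hB01 _).1]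
    exact mul_le_one₀ (mul_le_one₀ (hA01 _).2 (hB01 _).1 (hB01 _).2) (abs_nonneg _) (hb _ _)
  rw [h1, integral_prod _ hGi]
  have h2 := norm_integral_le_of_norm_le_const (μ := Measure.pi fun _ : ι => (volume : Measure USq))
    (C := cutNorm D) (f := fun p => ∫ w : USq × USq, A (Function.update p i w.1) *
      B (Function.update p j w.2) * D w.1 w.2 ∂(volume.prod volume))
    (Filter.Eventually.of_forall fun p =>
      abs_integral_mul_mul_le_cutNorm hD hb (hA.comp (measurable_update p)) (fun _ => hA01 _)
        (hB.comp (measurable_update p)) (fun _ => hB01 _))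
  simpa using h2

theorem prod_mem_Icc {κ : Type*} (s : Finset κ) (f : κ → ℝ)
    (h : ∀ k ∈ s, f k ∈ Set.Icc (0 : ℝ) 1) : ∏ k ∈ s, f k ∈ Set.Icc (0 : ℝ) 1 :=
  ⟨Finset.prod_nonneg fun k hk => (h k hk).1,
    Finset.prod_le_one (fun k hk => (h k hk).1) fun k hk => (h k hk).2⟩

/-- A kernel on the unit square that is measurable with values in `[0,1]`. -/
def IsKernel01 (P : USq → USq → ℝ) : Prop :=
  Measurable (Function.uncurry P) ∧ ∀ u v, P u v ∈ Set.Icc (0 : ℝ) 1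

/-- The increasing pairs of indices. -/
def incPairs (k : ℕ) : Finset (Fin k × Fin k) := Finset.univ.filter fun e => e.1 < e.2

/-- The density of the pattern with vertex weights `g` and edge weights `P`. -/
def patternWeight {k : ℕ} (g : Fin k → USq → ℝ) (P : Fin k × Fin k → USq → USq → ℝ)
    (p : Fin k → USq) : ℝ :=
  (∏ l, g l (p l)) * ∏ e ∈ incPairs k, P e (p e.1) (p e.2)

theorem measurable_patternWeight {k : ℕ} {g : Fin k → USq → ℝ}
    {P : Fin k × Fin k → USq → USq → ℝ} (hg : ∀ l, Measurable (g l))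
    (hP : ∀ e, Measurable (Function.uncurry (P e))) : Measurable (patternWeight g P) := by
  refine Measurable.mul (Finset.measurable_prod _ fun l _ => (hg l).comp (measurable_pi_apply l))
    (Finset.measurable_prod _ fun e _ =>
      measurable_kernel_eval (hP e) e.1 e.2)

theorem patternWeight_mem_Icc {k : ℕ} {g : Fin k → USq → ℝ}
    {P : Fin k × Fin k → USq → USq → ℝ} (hg01 : ∀ l u, g l u ∈ Set.Icc (0 : ℝ) 1)
    (hP : ∀ e, IsKernel01 (P e)) (p : Fin k → USq) : patternWeight g P p ∈ Set.Icc (0 : ℝ) 1 := by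
  have h1 := prod_mem_Icc Finset.univ (fun l => g l (p l)) fun l _ => hg01 _ _
  have h2 := prod_mem_Icc (incPairs k) (fun e => P e (p e.1) (p e.2)) fun e _ => (hP e).2 _ _
  exact ⟨mul_nonneg h1.1 h2.1, mul_le_one₀ h1.2 h2.1 h2.2⟩

theorem integrable_patternWeight {k : ℕ} {g : Fin k → USq → ℝ}
    {P : Fin k × Fin k → USq → USq → ℝ} (hg : ∀ l, Measurable (g l))
    (hg01 : ∀ l u, g l u ∈ Set.Icc (0 : ℝ) 1) (hP : ∀ e, IsKernel01 (P e)) :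
    Integrable (patternWeight g P) := by
  refine integrable_of_abs_le (C := 1) (measurable_patternWeight hg fun e => (hP e).1) fun p => ?_
  have := patternWeight_mem_Icc hg01 hP p
  rw [abs_of_nonneg this.1]
  exact this.2

theorem abs_sub_le_one_of_mem {x y : ℝ} (hx : x ∈ Set.Icc (0 : ℝ) 1)
    (hy : y ∈ Set.Icc (0 : ℝ) 1) : |x - y| ≤ 1 := by
  rw [abs_le]
  constructor <;> linarith [hx.1, hx.2, hy.1, hy.2]

theorem abs_integral_patternWeight_update_sub {k : ℕ} {g : Fin k → USq → ℝ}
    {P : Fin k × Fin k → USq → USq → ℝ} (hg : ∀ l, Measurable (g l))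
    (hg01 : ∀ l u, g l u ∈ Set.Icc (0 : ℝ) 1) (hP : ∀ e, IsKernel01 (P e))
    {e : Fin k × Fin k} (he : e.1 < e.2) {K : USq → USq → ℝ} (hK : IsKernel01 K) :
    |(∫ p, patternWeight g (Function.update P e K) p) - ∫ p, patternWeight g P p| ≤
      cutNorm (fun u v => K u v - P e u v) := by
  have hP' : ∀ e', IsKernel01 (Function.update P e K e') := fun e' => by
    by_cases h : e' = e
    · subst h; simpa using hK
    · simpa [Function.update_of_ne h] using hP e'
  rw [← integral_sub (integrable_patternWeight hg hg01 hP') (integrable_patternWeight hg hg01 hP)]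
  have hne : e.1 ≠ e.2 := he.ne
  have hemem : e ∈ incPairs k := by simp [incPairs, he]
  set A : (Fin k → USq) → ℝ := fun p => (∏ l ∈ Finset.univ.erase e.2, g l (p l)) *
    ∏ e' ∈ ((incPairs k).erase e).filter (fun e' => ¬(e'.1 = e.2 ∨ e'.2 = e.2)),
      P e' (p e'.1) (p e'.2) with hAdef
  set B : (Fin k → USq) → ℝ := fun p => g e.2 (p e.2) *
    ∏ e' ∈ ((incPairs k).erase e).filter (fun e' => e'.1 = e.2 ∨ e'.2 = e.2),
      P e' (p e'.1) (p e'.2) with hBdef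
  have hPm : ∀ e' : Fin k × Fin k, Measurable fun p : Fin k → USq => P e' (p e'.1) (p e'.2) :=
    fun e' => measurable_kernel_eval (hP e').1 e'.1 e'.2
  have hgm : ∀ l, Measurable fun p : Fin k → USq => g l (p l) :=
    fun l => (hg l).comp (measurable_pi_apply l)
  have key : ∀ p, patternWeight g (Function.update P e K) p - patternWeight g P p =
      A p * B p * (K (p e.1) (p e.2) - P e (p e.1) (p e.2)) := by
    intro p
    have h1 : ∏ e' ∈ (incPairs k).erase e, Function.update P e K e' (p e'.1) (p e'.2) =
        ∏ e' ∈ (incPairs k).erase e, P e' (p e'.1) (p e'.2) :=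
      Finset.prod_congr rfl fun e' he' => by
        rw [Function.update_of_ne (Finset.ne_of_mem_erase he')]
    have h2 := Finset.prod_filter_mul_prod_filter_not ((incPairs k).erase e)
      (fun e' => e'.1 = e.2 ∨ e'.2 = e.2) (fun e' => P e' (p e'.1) (p e'.2))
    simp only [patternWeight]
    rw [← Finset.mul_prod_erase _ _ hemem,
      ← Finset.mul_prod_erase _ (fun e' => P e' (p e'.1) (p e'.2)) hemem, h1, ← h2,
      ← Finset.mul_prod_erase _ _ (Finset.mem_univ e.2), hAdef, hBdef]
    simp only [Function.update_self]
    ring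
  simp only [key]
  refine abs_integral_mul_le_cutNorm (D := fun u v => K u v - P e u v) hne ?_ ?_ ?_ ?_ ?_ ?_
    (hK.1.sub (hP e).1) (fun u v => abs_sub_le_one_of_mem (hK.2 u v) ((hP e).2 u v))
  · exact (Finset.measurable_prod _ fun l _ => hgm l).mul
      (Finset.measurable_prod _ fun e' _ => hPm e')
  · exact (hgm _).mul (Finset.measurable_prod _ fun e' _ => hPm e')
  · intro p
    have h1 := prod_mem_Icc (Finset.univ.erase e.2) (fun l => g l (p l)) fun l _ => hg01 _ _
    have h2 := prod_mem_Icc (((incPairs k).erase e).filter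
      (fun e' => ¬(e'.1 = e.2 ∨ e'.2 = e.2))) (fun e => P e (p e.1) (p e.2))
      fun e _ => (hP e).2 _ _
    exact ⟨mul_nonneg h1.1 h2.1, mul_le_one₀ h1.2 h2.1 h2.2⟩
  · intro p
    have h2 := prod_mem_Icc (((incPairs k).erase e).filter
      (fun e' => e'.1 = e.2 ∨ e'.2 = e.2)) (fun e => P e (p e.1) (p e.2))
      fun e _ => (hP e).2 _ _
    exact ⟨mul_nonneg (hg01 _ _).1 h2.1, mul_le_one₀ (hg01 _ _).2 h2.1 h2.2⟩
  · intro p v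
    simp only [hAdef]
    congr 1
    · exact Finset.prod_congr rfl fun l hl => by
        rw [Function.update_of_ne (Finset.ne_of_mem_erase hl)]
    · refine Finset.prod_congr rfl fun e' he' => ?_
      have := (Finset.mem_filter.1 he').2
      push Not at this
      rw [Function.update_of_ne this.1, Function.update_of_ne this.2]
  · intro p u
    simp only [hBdef]
    rw [Function.update_of_ne hne.symm]
    congr 1
    refine Finset.prod_congr rfl fun e' he' => ?_
    obtain ⟨h1, h2⟩ := Finset.mem_filter.1 he'
    obtain ⟨h3, h4⟩ := Finset.mem_erase.1 h1
    have h5 : e'.1 < e'.2 := by simpa [incPairs] using h4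
    have h6 : e'.1 ≠ e.1 ∧ e'.2 ≠ e.1 := by
      rcases h2 with h2 | h2
      · constructor <;> intro h7 <;> [exact hne (h7 ▸ h2); skip]
        rw [h7, h2] at h5
        exact absurd h5 he.asymm
      · constructor <;> intro h7
        · exact h3 (Prod.ext h7 h2)
        · exact hne (h7 ▸ h2)
    rw [Function.update_of_ne h6.1, Function.update_of_ne h6.2]

theorem abs_integral_patternWeight_sub_le {k : ℕ} {g : Fin k → USq → ℝ}
    {P Q : Fin k × Fin k → USq → USq → ℝ} (hg : ∀ l, Measurable (g l))
    (hg01 : ∀ l u, g l u ∈ Set.Icc (0 : ℝ) 1) (hP : ∀ e, IsKernel01 (P e))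
    (hQ : ∀ e, IsKernel01 (Q e)) {c : ℝ} (hc : ∀ e, cutNorm (fun u v => P e u v - Q e u v) ≤ c) :
    |(∫ p, patternWeight g P p) - ∫ p, patternWeight g Q p| ≤ (k ^ 2 : ℝ) * c := by
  have hc0 : ∀ e : Fin k × Fin k, 0 ≤ c := fun e => (cutNorm_nonneg _).trans (hc e)
  have hstep : ∀ s : Finset (Fin k × Fin k), (∀ e ∈ s, e.1 < e.2) →
      |(∫ p, patternWeight g (s.piecewise P Q) p) - ∫ p, patternWeight g Q p| ≤
        (s.card : ℝ) * c := by
    intro s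
    induction s using Finset.induction_on with
    | empty => simp
    | insert e s hes ih =>
      intro hs
      have hker : ∀ e', IsKernel01 (s.piecewise P Q e') := fun e' => by
        by_cases h : e' ∈ s <;> simp [h, hP, hQ]
      have h1 := abs_integral_patternWeight_update_sub hg hg01 hker
        (hs e (Finset.mem_insert_self _ _)) (hP e)
      rw [← Finset.piecewise_insert, Finset.piecewise_eq_of_notMem _ _ _ hes] at h1
      have h2 := ih fun e' he' => hs e' (Finset.mem_insert_of_mem he')
      rw [Finset.card_insert_of_notMem hes]
      push_cast
      have h3 := abs_sub_le (∫ p, patternWeight g ((insert e s).piecewise P Q) p)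
        (∫ p, patternWeight g (s.piecewise P Q) p) (∫ p, patternWeight g Q p)
      linarith [hc e]
  have hall := hstep (incPairs k) fun e he => by simpa [incPairs] using he
  have hPw : patternWeight g ((incPairs k).piecewise P Q) = patternWeight g P := by
    ext p
    simp only [patternWeight]
    congr 1
    exact Finset.prod_congr rfl fun e he => by rw [Finset.piecewise_eq_of_mem _ _ _ he]
  rw [hPw] at hall
  refine hall.trans ?_
  rcases (incPairs k).eq_empty_or_nonempty with h | ⟨e, -⟩
  · rw [h]
    rcases Nat.eq_zero_or_pos k with rfl | hk
    · simp
    · simpa using mul_nonneg (by positivity) (hc0 (⟨0, hk⟩, ⟨0, hk⟩))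
  · refine mul_le_mul_of_nonneg_right ?_ (hc0 e)
    have : (incPairs k).card ≤ k * k := by
      refine (Finset.card_le_univ _).trans ?_
      simp
    rw [sq]
    exact_mod_cast this

/-! ### Samples from the closure of a hereditary property -/

theorem graphOrderon_apply {n : ℕ} [NeZero n] (G : SimpleGraph (Fin n)) (u v : USq) :
    graphOrderon G u v = if G.Adj (blockIdx n u.1) (blockIdx n v.1) then 1 else 0 := by
  have key : ∀ x : UI, Qn n x - 1 = (blockIdx n x : ℕ) := fun x => by
    simp only [Qn, blockIdx]
    omega
  simp only [graphOrderon, blockOrderon, graphAdjFun, key]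
  rw [dif_pos ⟨(blockIdx n u.1).2, (blockIdx n v.1).2⟩]

theorem measurable_comp_blockIdx {n : ℕ} [NeZero n] (w : Fin n → Fin n → ℝ) :
    Measurable (Function.uncurry fun u v : USq => w (blockIdx n u.1) (blockIdx n v.1)) := by
  have h : Measurable fun p : USq × USq => (blockIdx n p.1.1, blockIdx n p.2.1) :=
    ((measurable_blockIdx n).comp (measurable_fst.comp measurable_fst)).prodMk
      ((measurable_blockIdx n).comp (measurable_fst.comp measurable_snd))
  exact (measurable_of_finite fun e : Fin n × Fin n => w e.1 e.2).comp h

theorem isKernel01_graphOrderon {n : ℕ} [NeZero n] (G : SimpleGraph (Fin n)) :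
    IsKernel01 (graphOrderon G) := by
  have h : graphOrderon G = fun u v => (fun i j => if G.Adj i j then (1 : ℝ) else 0)
      (blockIdx n u.1) (blockIdx n v.1) := by
    ext u v
    simp only [graphOrderon_apply]
  refine ⟨?_, fun u v => ?_⟩
  · rw [h]
    exact measurable_comp_blockIdx fun i j => if G.Adj i j then (1 : ℝ) else 0
  · rw [graphOrderon_apply]
    split_ifs <;> simp

theorem inducedSG_image {n k : ℕ} (G : SimpleGraph (Fin n)) {φ : Fin k → Fin n}
    (hφ : StrictMono φ) : inducedSG G k (Finset.univ.image φ) = G.comap φ := by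
  have hc : (Finset.univ.image φ).card = k := by
    rw [Finset.card_image_of_injective _ hφ.injective, Finset.card_fin]
  rw [inducedSG, dif_pos hc]
  have h : (fun i => ((Finset.univ.image φ).orderIsoOfFin hc i : Fin n)) = φ := by
    have := Finset.orderEmbOfFin_unique hc (f := φ) (fun x => by simp) hφ
    exact this.symm
  rw [h]

theorem SimpleGraph.eq_of_adj_lt {k : ℕ} {F G : SimpleGraph (Fin k)}
    (h : ∀ i j, i < j → (F.Adj i j ↔ G.Adj i j)) : F = G := by
  ext i j
  rcases lt_trichotomy i j with hij | rfl | hij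
  · exact h i j hij
  · simp
  · rw [F.adj_comm, G.adj_comm, h j i hij]

/-- `F` has no edge where `w` vanishes and all the edges where `w` is one. -/
def SupportCompat {k : ℕ} (F : SimpleGraph (Fin k)) (w : Fin k → Fin k → ℝ) : Prop :=
  ∀ i j, i < j → (F.Adj i j → w i j ≠ 0) ∧ (¬F.Adj i j → w i j ≠ 1)

/-- The probability that an edge sampled from `U` agrees with `F`. -/
def edgeKernel {k : ℕ} (F : SimpleGraph (Fin k)) (U : USq → USq → ℝ) (e : Fin k × Fin k)
    (u v : USq) : ℝ :=
  if F.Adj e.1 e.2 then U u v else 1 - U u v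

theorem isKernel01_edgeKernel {k : ℕ} (F : SimpleGraph (Fin k)) {U : USq → USq → ℝ}
    (hU : IsKernel01 U) (e : Fin k × Fin k) : IsKernel01 (edgeKernel F U e) := by
  by_cases h : F.Adj e.1 e.2
  · have : edgeKernel F U e = U := by ext; simp [edgeKernel, h]
    rwa [this]
  · have : edgeKernel F U e = fun u v => 1 - U u v := by ext; simp [edgeKernel, h]
    rw [this]
    refine ⟨measurable_const.sub hU.1, fun u v => ?_⟩
    have := hU.2 u v
    constructor <;> linarith [this.1, this.2]

theorem cutNorm_edgeKernel_sub {k : ℕ} (F : SimpleGraph (Fin k)) (U V : USq → USq → ℝ)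
    (e : Fin k × Fin k) :
    cutNorm (fun u v => edgeKernel F U e u v - edgeKernel F V e u v) =
      cutNorm fun u v => U u v - V u v := by
  by_cases h : F.Adj e.1 e.2
  · simp [edgeKernel, h]
  · rw [← cutNorm_neg]
    simp [edgeKernel, h]

theorem IsKernel01.comp {U : USq → USq → ℝ} (hU : IsKernel01 U) {f : USq → USq}
    (hf : Measurable f) : IsKernel01 fun u v => U (f u) (f v) := by
  have h : Measurable fun p : USq × USq => (f p.1, f p.2) :=
    (hf.comp measurable_fst).prodMk (hf.comp measurable_snd)
  exact ⟨hU.1.comp h, fun u v => hU.2 _ _⟩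

/-- The vertical strip of points whose abscissa lies in `[a/N, (a+1)/N)`. -/
def strip (N a : ℕ) : Set USq := {u | ⌊(N : ℝ) * u.1⌋₊ = a}

theorem measurableSet_strip (N a : ℕ) : MeasurableSet (strip N a) := by
  have h : Measurable fun u : USq => ⌊(N : ℝ) * u.1⌋₊ :=
    Nat.measurable_floor.comp (by fun_prop)
  exact h (measurableSet_singleton a)

theorem indicator_one_mem_Icc {α : Type*} (s : Set α) (x : α) :
    s.indicator (1 : α → ℝ) x ∈ Set.Icc (0 : ℝ) 1 := by
  by_cases h : x ∈ s <;> simp [h]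

theorem inv_le_sub_of_mem_strip {N a b : ℕ} (hN : 0 < N) (hab : a + 1 < b) {u v : USq}
    (hu : u ∈ strip N a) (hv : v ∈ strip N b) : 1 / (N : ℝ) ≤ (v.1 : ℝ) - u.1 := by
  have hN' : (0 : ℝ) < N := by exact_mod_cast hN
  have h1 : (N : ℝ) * u.1 < a + 1 := by
    have := Nat.lt_floor_add_one ((N : ℝ) * u.1)
    rwa [show ⌊(N : ℝ) * u.1⌋₊ = a from hu] at this
  have h2 : (b : ℝ) ≤ N * v.1 := by
    have := Nat.floor_le (mul_nonneg hN'.le v.1.2.1)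
    rwa [show ⌊(N : ℝ) * v.1⌋₊ = b from hv] at this
  have h3 : (a : ℝ) + 2 ≤ b := by exact_mod_cast hab
  rw [div_le_iff₀ hN']
  nlinarith

theorem blockIdx_lt_of_lt {m : ℕ} [NeZero m] {x y : UI} (h : 1 / (m : ℝ) < (y : ℝ) - x) :
    blockIdx m x < blockIdx m y := by
  have hm : (0 : ℝ) < m := by exact_mod_cast Nat.pos_of_ne_zero (NeZero.ne m)
  rw [div_lt_iff₀ hm] at h
  have h1 := (blockIdx_le_mul m x).1
  have h2 := (blockIdx_le_mul m y).2
  have h3 : ((blockIdx m x : ℕ) : ℝ) < (blockIdx m y : ℕ) := by nlinarith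
  exact_mod_cast h3

theorem integral_patternWeight_eq_zero {H : ∀ n, Set (SimpleGraph (Fin n))} (hH : Hereditary H)
    {U : USq → USq → ℝ} (hU : InClosure H U) {k : ℕ} {F : SimpleGraph (Fin k)} (hF : F ∉ H k)
    {N : ℕ} (hN : 0 < N) {a : Fin k → ℕ} (ha : ∀ i j, i < j → a i + 1 < a j) :
    ∫ p, patternWeight (fun l => (strip N (a l)).indicator 1) (edgeKernel F U) p = 0 := by
  obtain ⟨hUo, m, G, hG, hm, hlim⟩ := hU
  have hUk : IsKernel01 U := ⟨hUo.1, hUo.2.1⟩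
  set g : Fin k → USq → ℝ := fun l => (strip N (a l)).indicator 1 with hgdef
  have hg : ∀ l, Measurable (g l) := fun l => measurable_one.indicator (measurableSet_strip _ _)
  have hg01 : ∀ l u, g l u ∈ Set.Icc (0 : ℝ) 1 := fun l u => indicator_one_mem_Icc _ _
  set c := ∫ p, patternWeight g (edgeKernel F U) p with hc
  have hc0 : 0 ≤ c := integral_nonneg fun p =>
    (patternWeight_mem_Icc hg01 (fun e => isKernel01_edgeKernel F hUk e) p).1
  by_contra hne
  have hcpos : 0 < c := lt_of_le_of_ne hc0 (Ne.symm hne)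
  have hN' : (0 : ℝ) < N := by exact_mod_cast hN
  obtain ⟨η, hη0, hη1, hη2⟩ : ∃ η : ℝ, 0 < η ∧ (k ^ 2 : ℝ) * η < c ∧ 2 * η ≤ 1 / (4 * N) := by
    refine ⟨min (c / (k ^ 2 + 1)) (1 / (8 * N)), by positivity, ?_, ?_⟩
    · calc (k ^ 2 : ℝ) * min (c / (k ^ 2 + 1)) (1 / (8 * (N : ℝ)))
          ≤ (k ^ 2 : ℝ) * (c / (k ^ 2 + 1)) := by gcongr; exact min_le_left _ _
        _ < c := by
          rw [mul_div_assoc', div_lt_iff₀ (by positivity)]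
          linarith
    · have := min_le_right (c / (k ^ 2 + 1 : ℝ)) (1 / (8 * (N : ℝ)))
      have h2 : 1 / (4 * (N : ℝ)) = 2 * (1 / (8 * N)) := by field_simp; norm_num
      linarith
  obtain ⟨l, hl1, hl2⟩ := ((hlim.eventually (gt_mem_nhds hη0)).and
    (hm.eventually_ge_atTop (2 * N))).exists
  have : NeZero (m l) := ⟨by omega⟩
  have hml : (2 * N : ℝ) ≤ m l := by exact_mod_cast hl2
  obtain ⟨f, hf, hshift, hcut⟩ := exists_isMPB_of_csDist_lt hl1
  have hUf := hUk.comp hf.1.measurable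
  have hgf : ∀ l, Measurable (g l ∘ f) := fun l => (hg l).comp hf.1.measurable
  have hgf01 : ∀ l u, (g l ∘ f) u ∈ Set.Icc (0 : ℝ) 1 := fun l u => hg01 _ _
  have hcount := abs_integral_patternWeight_sub_le hgf hgf01
    (fun e => isKernel01_edgeKernel F (isKernel01_graphOrderon (G l)) e)
    (fun e => isKernel01_edgeKernel F hUf e)
    (c := η) (fun e => by rw [cutNorm_edgeKernel_sub]; exact hcut.le)
  have hpi : MeasurePreserving (fun p : Fin k → USq => fun i => f (p i)) volume volume :=
    volume_preserving_pi fun _ => hf.1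
  have hceq : ∫ p, patternWeight (fun l => g l ∘ f)
      (edgeKernel F fun u v => U (f u) (f v)) p = c := by
    have h := integral_map (μ := (volume : Measure (Fin k → USq))) hpi.measurable.aemeasurable
      (f := patternWeight g (edgeKernel F U))
      (measurable_patternWeight hg
        fun e => (isKernel01_edgeKernel F hUk e).1).aestronglyMeasurable
    rw [hpi.map_eq] at h
    rw [hc, h]
    rfl
  rw [hceq] at hcount
  have hpos : ∫ p, patternWeight (fun l => g l ∘ f) (edgeKernel F (graphOrderon (G l))) p ≠ 0 := by
    intro h0
    rw [h0, zero_sub, abs_neg, abs_of_pos hcpos] at hcount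
    linarith
  obtain ⟨p, hp⟩ : ∃ p, patternWeight (fun l => g l ∘ f)
      (edgeKernel F (graphOrderon (G l))) p ≠ 0 := by
    by_contra! hall
    exact hpos (by simp [hall])
  have hp1 := Finset.prod_ne_zero_iff.1 (left_ne_zero_of_mul hp)
  have hp2 := Finset.prod_ne_zero_iff.1 (right_ne_zero_of_mul hp)
  have hmem : ∀ i, f (p i) ∈ strip N (a i) := fun i => by
    by_contra h
    exact hp1 i (Finset.mem_univ i) (by simp [hgdef, h])
  have hmono : StrictMono fun i => blockIdx (m l) (p i).1 := by
    intro i j hij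
    refine blockIdx_lt_of_lt ?_
    have h1 := inv_le_sub_of_mem_strip hN (ha i j hij) (hmem i) (hmem j)
    have h2 := abs_le.1 (abs_sub_le_shiftOf f (p i))
    have h3 := abs_le.1 (abs_sub_le_shiftOf f (p j))
    have h4 : 1 / (m l : ℝ) ≤ 1 / (2 * N) := by gcongr
    have h5 : 1 / (2 * (N : ℝ)) = 1 / N - 2 * (1 / (4 * N)) := by field_simp; norm_num
    have h6 : 0 < 1 / (4 * (N : ℝ)) := by positivity
    linarith [h2.1, h2.2, h3.1, h3.2]
  refine hF ?_
  have hFG : F = (G l).comap fun i => blockIdx (m l) (p i).1 := by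
    refine SimpleGraph.eq_of_adj_lt fun i j hij => ?_
    have h := hp2 (i, j) (by simp [incPairs, hij])
    rw [edgeKernel, graphOrderon_apply] at h
    rw [SimpleGraph.comap_adj]
    by_cases h1 : F.Adj i j <;>
      by_cases h2 : (G l).Adj (blockIdx (m l) (p i).1) (blockIdx (m l) (p j).1) <;>
      simp_all
  rw [hFG, ← inducedSG_image (G l) hmono]
  exact hH _ _ _ (hG l) _ (by rw [Finset.card_image_of_injective _ hmono.injective,
    Finset.card_fin])

theorem ae_mem_of_supportCompat {H : ∀ n, Set (SimpleGraph (Fin n))} (hH : Hereditary H)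
    {U : USq → USq → ℝ} (hU : InClosure H U) (k : ℕ) :
    ∀ᵐ p : Fin k → USq, (∀ i j, i < j → (p i).1 < (p j).1) →
      ∀ F : SimpleGraph (Fin k), SupportCompat F (fun i j => U (p i) (p j)) → F ∈ H k := by
  have hUk : IsKernel01 U := ⟨hU.1.1, hU.1.2.1⟩
  have hzero : ∀ᵐ p : Fin k → USq, ∀ (F : SimpleGraph (Fin k)) (_ : F ∉ H k) (N : ℕ) (_ : 0 < N)
      (a : Fin k → ℕ) (_ : ∀ i j, i < j → a i + 1 < a j),
      patternWeight (fun l => (strip N (a l)).indicator 1) (edgeKernel F U) p = 0 := by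
    simp only [ae_all_iff]
    intro F hF N hN a ha
    have hg : ∀ l : Fin k, Measurable ((strip N (a l)).indicator (1 : USq → ℝ)) :=
      fun l => measurable_one.indicator (measurableSet_strip _ _)
    have hg01 : ∀ (l : Fin k) u, (strip N (a l)).indicator (1 : USq → ℝ) u ∈ Set.Icc (0 : ℝ) 1 :=
      fun l u => indicator_one_mem_Icc _ _
    exact (integral_eq_zero_iff_of_nonneg
      (fun p => (patternWeight_mem_Icc hg01 (fun e => isKernel01_edgeKernel F hUk e) p).1)
      (integrable_patternWeight hg hg01 fun e => isKernel01_edgeKernel F hUk e)).1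
      (integral_patternWeight_eq_zero hH hU hF hN ha)
  filter_upwards [hzero] with p hp hmono F hF
  by_contra hFH
  obtain ⟨N, hN, hN0⟩ : ∃ N : ℕ, (∀ i j, i < j → 2 ≤ N * (((p j).1 : ℝ) - (p i).1)) ∧ 0 < N := by
    have h : ∀ i j, i < j → ∀ᶠ N : ℕ in atTop, 2 ≤ (N : ℝ) * (((p j).1 : ℝ) - (p i).1) := by
      intro i j hij
      have hpos : 0 < ((p j).1 : ℝ) - (p i).1 := sub_pos.2 (hmono i j hij)
      exact (tendsto_natCast_atTop_atTop.atTop_mul_const hpos).eventually_ge_atTop 2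
    simp only [← eventually_all] at h
    exact (h.and (eventually_gt_atTop 0)).exists
  have hz := hp F hFH N hN0 (fun i => ⌊(N : ℝ) * (p i).1⌋₊) fun i j hij => by
    have h1 := Nat.floor_le (mul_nonneg (Nat.cast_nonneg N) (p i).1.2.1)
    have h2 := Nat.lt_floor_add_one ((N : ℝ) * (p j).1)
    have h3 := hN i j hij
    have h4 : (⌊(N : ℝ) * (p i).1⌋₊ : ℝ) + 1 < ⌊(N : ℝ) * (p j).1⌋₊ := by nlinarith
    exact_mod_cast h4
  rcases mul_eq_zero.1 hz with h | h
  · obtain ⟨i, -, hi⟩ := Finset.prod_eq_zero_iff.1 h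
    have hmem : p i ∈ strip N ⌊(N : ℝ) * (p i).1⌋₊ := rfl
    simp [hmem] at hi
  · obtain ⟨e, he, hi⟩ := Finset.prod_eq_zero_iff.1 h
    have he' : e.1 < e.2 := by simpa [incPairs] using he
    have := hF e.1 e.2 he'
    rw [edgeKernel] at hi
    split_ifs at hi with hadj
    · exact this.1 hadj hi
    · exact this.2 hadj (by linarith)

/-! ### Rounding a weighted graph to a graph -/

theorem exp_two_point_le {w s : ℝ} (hw : w ∈ Set.Icc (0 : ℝ) 1) (hs : |s| ≤ 1) :
    w * Real.exp (s * (1 - w)) + (1 - w) * Real.exp (s * (0 - w)) ≤ Real.exp (s ^ 2) := by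
  have hq : ∀ x : ℝ, |x| ≤ 1 → Real.exp x ≤ 1 + x + x ^ 2 := fun x hx => by
    have := (abs_le.1 (Real.abs_exp_sub_one_sub_id_le hx)).2
    linarith
  obtain ⟨h0, h1⟩ := hw
  have e1 : |s * (1 - w)| ≤ 1 := by
    rw [abs_mul, abs_of_nonneg (by linarith : 0 ≤ 1 - w)]
    exact mul_le_one₀ hs (by linarith) (by linarith)
  have e2 : |s * (0 - w)| ≤ 1 := by
    rw [abs_mul, zero_sub, abs_neg, abs_of_nonneg h0]
    exact mul_le_one₀ hs h0 h1
  have h2 := mul_le_mul_of_nonneg_left (hq _ e1) h0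
  have h3 := mul_le_mul_of_nonneg_left (hq _ e2) (by linarith : 0 ≤ 1 - w)
  have h4 := Real.add_one_le_exp (s ^ 2)
  have h5 : s ^ 2 * (w * (1 - w)) ≤ s ^ 2 * 1 :=
    mul_le_mul_of_nonneg_left (by nlinarith) (sq_nonneg s)
  nlinarith

theorem exists_rounding_exp_le {ι γ : Type*} (E : Finset ι) (C : Finset γ) {w : ι → ℝ}
    (hw : ∀ e, w e ∈ Set.Icc (0 : ℝ) 1) {c : γ → ι → ℝ} (hc : ∀ g e, |c g e| ≤ 1) :
    ∀ A : γ → ℝ, (∀ g, 0 ≤ A g) → ∃ F : ι → Prop,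
      (∀ e, (F e → w e ≠ 0) ∧ (¬F e → w e ≠ 1)) ∧
      ∑ g ∈ C, A g * Real.exp (∑ e ∈ E, c g e * ((if F e then 1 else 0) - w e)) ≤
        ∑ g ∈ C, A g * Real.exp (∑ e ∈ E, c g e ^ 2) := by
  induction E using Finset.induction_on with
  | empty =>
    intro A _
    exact ⟨fun e => w e ≠ 0, fun e => ⟨id, fun h => by
      rw [not_not.1 h]; exact zero_ne_one⟩, by simp⟩
  | insert a E ha ih =>
    intro A hA
    obtain ⟨b, hb1, hb2⟩ : ∃ b : Prop, ((b → w a ≠ 0) ∧ (¬b → w a ≠ 1)) ∧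
        ∑ g ∈ C, A g * Real.exp (c g a * ((if b then 1 else 0) - w a)) *
          Real.exp (∑ e ∈ E, c g e ^ 2) ≤
        ∑ g ∈ C, A g * Real.exp (∑ e ∈ insert a E, c g e ^ 2) := by
      have havg : w a * (∑ g ∈ C, A g * Real.exp (c g a * (1 - w a)) *
            Real.exp (∑ e ∈ E, c g e ^ 2)) +
          (1 - w a) * (∑ g ∈ C, A g * Real.exp (c g a * (0 - w a)) *
            Real.exp (∑ e ∈ E, c g e ^ 2)) ≤
          ∑ g ∈ C, A g * Real.exp (∑ e ∈ insert a E, c g e ^ 2) := by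
        rw [Finset.mul_sum, Finset.mul_sum, ← Finset.sum_add_distrib]
        refine Finset.sum_le_sum fun g _ => ?_
        rw [Finset.sum_insert ha, Real.exp_add]
        have h1 := mul_le_mul_of_nonneg_left (exp_two_point_le (hw a) (hc g a))
          (mul_nonneg (hA g) (Real.exp_pos (∑ e ∈ E, c g e ^ 2)).le)
        linarith
      obtain ⟨h0, h1⟩ := hw a
      by_cases hT : (∑ g ∈ C, A g * Real.exp (c g a * (1 - w a)) *
          Real.exp (∑ e ∈ E, c g e ^ 2)) ≤
          ∑ g ∈ C, A g * Real.exp (∑ e ∈ insert a E, c g e ^ 2) ∧ w a ≠ 0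
      · exact ⟨True, ⟨fun _ => hT.2, fun h => (h trivial).elim⟩, by simpa using hT.1⟩
      · have hw1 : w a ≠ 1 := fun h => hT ⟨by rw [h] at havg ⊢; linarith, by rw [h]; simp⟩
        refine ⟨False, ⟨fun h => h.elim, fun _ => hw1⟩, ?_⟩
        simp only [if_false]
        rcases eq_or_ne (w a) 0 with hw0 | hw0
        · rw [hw0] at havg ⊢
          linarith
        · have hT' := not_le.1 fun h => hT ⟨h, hw0⟩
          by_contra hlt
          push Not at hlt
          have hpos : 0 < w a := lt_of_le_of_ne h0 hw0.symm
          have hlt1 : w a < 1 := lt_of_le_of_ne h1 hw1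
          nlinarith [mul_lt_mul_of_pos_left hT' hpos,
            mul_lt_mul_of_pos_left hlt (by linarith : 0 < 1 - w a)]
    obtain ⟨F, hF1, hF2⟩ := ih (fun g => A g * Real.exp (c g a * ((if b then 1 else 0) - w a)))
      fun g => mul_nonneg (hA g) (Real.exp_pos _).le
    refine ⟨Function.update F a b, fun e => ?_, le_trans (le_of_eq ?_) (hF2.trans hb2)⟩
    · rcases eq_or_ne e a with rfl | he
      · simpa using hb1
      · simpa [Function.update_of_ne he] using hF1 e
    · refine Finset.sum_congr rfl fun g _ => ?_
      rw [Finset.sum_insert ha, Real.exp_add, ← mul_assoc, Function.update_self]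
      congr 2
      refine Finset.sum_congr rfl fun e he => ?_
      rw [Function.update_of_ne (ne_of_mem_of_not_mem he ha)]

/-- The signed error made when the weighted graph `w` is replaced by the graph `F`. -/
def roundingError {n : ℕ} (F : SimpleGraph (Fin n)) (w : Fin n → Fin n → ℝ) (i j : Fin n) : ℝ :=
  if i = j then 0 else (if F.Adj i j then 1 else 0) - w i j

theorem sum_eq_sum_incPairs {n : ℕ} (X : Fin n → Fin n → ℝ) (h : ∀ i, X i i = 0) :
    ∑ i, ∑ j, X i j = ∑ e ∈ incPairs n, (X e.1 e.2 + X e.2 e.1) := by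
  have h1 : ∑ i, ∑ j, X i j = ∑ e : Fin n × Fin n, X e.1 e.2 := by
    rw [Fintype.sum_prod_type]
  have h2 : ∑ e ∈ incPairs n, X e.2 e.1 =
      ∑ e ∈ Finset.univ.filter (fun e : Fin n × Fin n => e.2 < e.1), X e.1 e.2 := by
    refine Finset.sum_bij' (fun e _ => e.swap) (fun e _ => e.swap) ?_ ?_ ?_ ?_ ?_ <;>
      simp [incPairs]
  rw [h1, Finset.sum_add_distrib, h2, incPairs, ← Finset.sum_filter_add_sum_filter_not
    Finset.univ (fun e : Fin n × Fin n => e.1 < e.2)]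
  congr 1
  symm
  refine Finset.sum_subset (fun e => ?_) fun e he1 he2 => ?_
  · simp only [Finset.mem_filter, Finset.mem_univ, true_and, not_lt]
    exact le_of_lt
  · simp only [Finset.mem_filter, Finset.mem_univ, true_and, not_lt] at he1 he2
    rw [le_antisymm he1 he2, h]

theorem exists_graph_roundingError_le {n : ℕ} {w : Fin n → Fin n → ℝ}
    (hw : ∀ i j, w i j ∈ Set.Icc (0 : ℝ) 1) (hsymm : ∀ i j, w i j = w j i) {r : ℝ} (hr : 0 < r)
    (hr1 : 2 * r ≤ 1) :
    ∃ F : SimpleGraph (Fin n), SupportCompat F w ∧ ∀ S T : Finset (Fin n),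
      |∑ i ∈ S, ∑ j ∈ T, roundingError F w i j| ≤ (1 + 2 * n) / r + 4 * r * n ^ 2 := by
  let ind : Finset (Fin n) → Fin n → ℝ := fun S i => if i ∈ S then 1 else 0
  have hind : ∀ S i, 0 ≤ ind S i ∧ ind S i ≤ 1 := fun S i => by
    simp only [ind]; split_ifs <;> simp
  let b : Finset (Fin n) × Finset (Fin n) → Fin n × Fin n → ℝ := fun P e =>
    ind P.1 e.1 * ind P.2 e.2 + ind P.1 e.2 * ind P.2 e.1
  have hb : ∀ P e, 0 ≤ b P e ∧ b P e ≤ 2 := fun P e => by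
    have h1 := mul_le_one₀ (hind P.1 e.1).2 (hind P.2 e.2).1 (hind P.2 e.2).2
    have h2 := mul_le_one₀ (hind P.1 e.2).2 (hind P.2 e.1).1 (hind P.2 e.1).2
    have h3 := mul_nonneg (hind P.1 e.1).1 (hind P.2 e.2).1
    have h4 := mul_nonneg (hind P.1 e.2).1 (hind P.2 e.1).1
    constructor <;> simp only [b] <;> linarith
  let c : (Finset (Fin n) × Finset (Fin n)) × Bool → Fin n × Fin n → ℝ := fun g e =>
    r * ((if g.2 then 1 else -1) * b g.1 e)
  have hc : ∀ g e, |c g e| ≤ 2 * r := fun g e => by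
    simp only [c]
    rw [abs_mul, abs_mul, abs_of_pos hr, abs_of_nonneg (hb g.1 e).1]
    have : |(if g.2 then 1 else -1 : ℝ)| = 1 := by split_ifs <;> simp
    rw [this]
    nlinarith [(hb g.1 e).2]
  obtain ⟨A, hA1, hA2⟩ := exists_rounding_exp_le (incPairs n) Finset.univ
    (w := fun e : Fin n × Fin n => w e.1 e.2) (fun e => hw e.1 e.2)
    (c := c) (fun g e => (hc g e).trans hr1) (fun _ => 1) fun _ => zero_le_one
  simp only [one_mul] at hA2
  let F : SimpleGraph (Fin n) :=
    { Adj := fun i j => (i < j ∧ A (i, j)) ∨ (j < i ∧ A (j, i))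
      symm := ⟨fun i j h => h.symm⟩
      loopless := ⟨fun i h => by simp at h⟩ }
  have hFA : ∀ i j, i < j → (F.Adj i j ↔ A (i, j)) := fun i j hij => by
    simp [F, hij, hij.asymm]
  refine ⟨F, fun i j hij => by rw [hFA i j hij]; exact hA1 (i, j), fun S T => ?_⟩
  have hXsymm : ∀ i j, roundingError F w i j = roundingError F w j i := fun i j => by
    simp only [roundingError, eq_comm (a := i), hsymm i j, F.adj_comm i j]
    congr
  have hsum : ∑ i ∈ S, ∑ j ∈ T, roundingError F w i j =
      ∑ e ∈ incPairs n, b (S, T) e * ((if A e then 1 else 0) - w e.1 e.2) := by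
    have h1 : ∑ i ∈ S, ∑ j ∈ T, roundingError F w i j =
        ∑ i, ∑ j, ind S i * ind T j * roundingError F w i j := by
      simp only [ind, ite_mul, one_mul, zero_mul, Finset.sum_ite_mem, Finset.univ_inter,
        Finset.sum_ite_irrel, Finset.sum_const_zero]
    rw [h1, sum_eq_sum_incPairs _ fun i => by simp [roundingError]]
    refine Finset.sum_congr rfl fun e he => ?_
    have he' : e.1 < e.2 := by simpa [incPairs] using he
    rw [hXsymm e.2 e.1, ← add_mul, roundingError, if_neg he'.ne]
    simp only [b, hFA e.1 e.2 he']
  have hRHS : ∑ g, Real.exp (∑ e ∈ incPairs n, c g e ^ 2) ≤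
      Real.exp (1 + 2 * n + 4 * r ^ 2 * n ^ 2) := by
    have h1 : ∀ g, Real.exp (∑ e ∈ incPairs n, c g e ^ 2) ≤ Real.exp (4 * r ^ 2 * n ^ 2) := by
      intro g
      refine Real.exp_le_exp.2 ?_
      have hcard : ((incPairs n).card : ℝ) ≤ n ^ 2 := by
        have : (incPairs n).card ≤ n * n := (Finset.card_le_univ _).trans (by simp)
        rw [sq]; exact_mod_cast this
      calc ∑ e ∈ incPairs n, c g e ^ 2 ≤ ∑ e ∈ incPairs n, 4 * r ^ 2 :=
            Finset.sum_le_sum fun e _ => by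
              have := sq_le_sq' (abs_le.1 (hc g e)).1 (abs_le.1 (hc g e)).2
              linarith
        _ = (incPairs n).card * (4 * r ^ 2) := by rw [Finset.sum_const, nsmul_eq_mul]
        _ ≤ n ^ 2 * (4 * r ^ 2) := by gcongr
        _ = 4 * r ^ 2 * n ^ 2 := by ring
    refine (Finset.sum_le_sum fun g _ => h1 g).trans ?_
    rw [Finset.sum_const, nsmul_eq_mul, Real.exp_add, Real.exp_add, Finset.card_univ]
    refine mul_le_mul_of_nonneg_right ?_ (Real.exp_pos _).le
    have e1 : (2 : ℝ) ≤ Real.exp 1 := by linarith [Real.add_one_le_exp (1 : ℝ)]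
    have e2 : Real.exp (2 * n) = (Real.exp 1 * Real.exp 1) ^ n := by
      rw [← Real.exp_add, ← Real.exp_nat_mul]; congr 1; ring
    have e3 : (4 : ℝ) ^ n ≤ Real.exp (2 * n) := by
      rw [e2]
      exact pow_le_pow_left₀ (by norm_num) (by nlinarith) n
    have e4 : (Fintype.card ((Finset (Fin n) × Finset (Fin n)) × Bool) : ℝ) = 2 * 4 ^ n := by
      simp only [Fintype.card_prod, Fintype.card_finset, Fintype.card_fin, Fintype.card_bool]
      push_cast
      rw [← mul_pow]
      norm_num
      ring
    rw [e4]
    exact mul_le_mul e1 e3 (by positivity) (Real.exp_pos _).le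
  have hone : ∀ s : Bool, r * ((if s then 1 else -1) * ∑ i ∈ S, ∑ j ∈ T, roundingError F w i j) ≤
      1 + 2 * n + 4 * r ^ 2 * n ^ 2 := fun s => by
    rw [← Real.exp_le_exp]
    refine le_trans (le_trans (le_of_eq ?_) (Finset.single_le_sum (f := fun g =>
      Real.exp (∑ e ∈ incPairs n, c g e * ((if A e then 1 else 0) - w e.1 e.2)))
      (fun g _ => (Real.exp_pos _).le) (Finset.mem_univ ((S, T), s)))) (hA2.trans hRHS)
    rw [hsum, Finset.mul_sum, Finset.mul_sum]
    congr 1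
    refine Finset.sum_congr rfl fun e _ => ?_
    simp only [c]
    ring
  have hB : (1 + 2 * n) / r + 4 * r * n ^ 2 = (1 + 2 * n + 4 * r ^ 2 * n ^ 2) / r := by
    field_simp
  rw [hB, le_div_iff₀ hr]
  have hp := hone true
  have hm := hone false
  simp only [if_true, one_mul, Bool.false_eq_true, if_false] at hp hm
  rw [mul_comm, ← abs_of_pos hr, ← abs_mul, abs_of_pos hr, abs_le]
  constructor <;> linarith

theorem sum_mul_le_mul_sum_filter {ι : Type*} [Fintype ι] {s y : ι → ℝ} {c : ℝ}
    (hs : ∀ i, s i ∈ Set.Icc 0 c) :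
    ∑ i, s i * y i ≤ c * ∑ i ∈ Finset.univ.filter (fun i => 0 < y i), y i := by
  rw [Finset.sum_filter, Finset.mul_sum]
  refine Finset.sum_le_sum fun i _ => ?_
  split_ifs with h
  · exact mul_le_mul_of_nonneg_right (hs i).2 h.le
  · rw [mul_zero]
    exact mul_nonpos_of_nonneg_of_nonpos (hs i).1 (not_lt.1 h)

theorem sum_sum_mul_le {ι : Type*} [Fintype ι] {X : ι → ι → ℝ} {s t : ι → ℝ} {c B : ℝ}
    (hc : 0 ≤ c) (hs : ∀ i, s i ∈ Set.Icc 0 c) (ht : ∀ i, t i ∈ Set.Icc 0 c)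
    (hX : ∀ S T : Finset ι, ∑ i ∈ S, ∑ j ∈ T, X i j ≤ B) :
    ∑ i, ∑ j, s i * t j * X i j ≤ c ^ 2 * B := by
  have h1 : ∑ i, ∑ j, s i * t j * X i j = ∑ i, s i * ∑ j, t j * X i j := by
    simp only [Finset.mul_sum, mul_assoc]
  rw [h1]
  refine (sum_mul_le_mul_sum_filter hs).trans ?_
  rw [sq, mul_assoc]
  refine mul_le_mul_of_nonneg_left ?_ hc
  rw [Finset.sum_comm]
  simp only [← Finset.mul_sum]
  refine (sum_mul_le_mul_sum_filter ht).trans (mul_le_mul_of_nonneg_left ?_ hc)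
  rw [Finset.sum_comm]
  exact hX _ _

theorem abs_sum_sum_mul_le {ι : Type*} [Fintype ι] {X : ι → ι → ℝ} {s t : ι → ℝ} {c B : ℝ}
    (hc : 0 ≤ c) (hs : ∀ i, s i ∈ Set.Icc 0 c) (ht : ∀ i, t i ∈ Set.Icc 0 c)
    (hX : ∀ S T : Finset ι, |∑ i ∈ S, ∑ j ∈ T, X i j| ≤ B) :
    |∑ i, ∑ j, s i * t j * X i j| ≤ c ^ 2 * B := by
  refine abs_le'.2 ⟨sum_sum_mul_le hc hs ht fun S T => (le_abs_self _).trans (hX S T), ?_⟩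
  have := sum_sum_mul_le (X := fun i j => -X i j) hc hs ht (B := B) fun S T => by
    simp only [Finset.sum_neg_distrib]
    exact (neg_le_abs _).trans (hX S T)
  simpa using this

/-! ### Sampling one point in each box of a grid -/

theorem volume_preimage_blockIdx (m : ℕ) [NeZero m] (a : Fin m) :
    (volume : Measure UI) (blockIdx m ⁻¹' {a}) = (m : ℝ≥0∞)⁻¹ := by
  have h : MeasurePreserving (blockIdx m) volume (finUnif m) :=
    measurePreserving_fst.comp (measurePreserving_blockSplit m)
  rw [h.measure_preimage (measurableSet_singleton a).nullMeasurableSet]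
  simp [finUnif]

/-- The boxes of the grid cutting the unit square into `m²` equal boxes. -/
def gridBox (m : ℕ) [NeZero m] (c : Fin m × Fin m) : Set USq :=
  (blockIdx m ⁻¹' {c.1}) ×ˢ (blockIdx m ⁻¹' {c.2})

theorem mem_gridBox {m : ℕ} [NeZero m] {c : Fin m × Fin m} {u : USq} :
    u ∈ gridBox m c ↔ blockIdx m u.1 = c.1 ∧ blockIdx m u.2 = c.2 := by
  simp [gridBox]

theorem measurableSet_gridBox (m : ℕ) [NeZero m] (c : Fin m × Fin m) :
    MeasurableSet (gridBox m c) :=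
  (measurable_blockIdx m (measurableSet_singleton _)).prod
    (measurable_blockIdx m (measurableSet_singleton _))

/-- The uniform probability measure on a box of the grid. -/
def boxLaw (m : ℕ) [NeZero m] (c : Fin m × Fin m) : Measure USq :=
  ((m : ℝ≥0∞) * m) • (volume : Measure USq).restrict (gridBox m c)

instance (m : ℕ) [NeZero m] (c : Fin m × Fin m) : IsProbabilityMeasure (boxLaw m c) := by
  constructor
  have hm : (m : ℝ≥0∞) ≠ 0 := by exact_mod_cast NeZero.ne m
  have hv : (volume : Measure USq) (gridBox m c) = (m : ℝ≥0∞)⁻¹ * (m : ℝ≥0∞)⁻¹ := by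
    rw [gridBox, Measure.volume_eq_prod, Measure.prod_prod, volume_preimage_blockIdx,
      volume_preimage_blockIdx]
  rw [boxLaw, Measure.smul_apply, Measure.restrict_apply_univ, hv, smul_eq_mul, mul_assoc,
    ← mul_assoc (m : ℝ≥0∞) (m : ℝ≥0∞)⁻¹, ENNReal.mul_inv_cancel hm (ENNReal.natCast_ne_top m),
    one_mul, ENNReal.mul_inv_cancel hm (ENNReal.natCast_ne_top m)]

theorem pi_boxLaw_eq (m : ℕ) [NeZero m] :
    Measure.pi (boxLaw m) = (∏ _c : Fin m × Fin m, ((m : ℝ≥0∞) * m)) •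
      (volume : Measure (Fin m × Fin m → USq)).restrict (Set.univ.pi fun c => gridBox m c) := by
  refine Measure.pi_eq fun s _ => ?_
  rw [volume_pi, Measure.restrict_pi_pi, Measure.smul_apply, Measure.pi_pi, smul_eq_mul,
    ← Finset.prod_mul_distrib]
  rfl

theorem pi_boxLaw_absolutelyContinuous (m : ℕ) [NeZero m] :
    Measure.pi (boxLaw m) ≪ (volume : Measure (Fin m × Fin m → USq)) := by
  rw [pi_boxLaw_eq]
  exact Measure.AbsolutelyContinuous.smul_left Measure.absolutelyContinuous_restrict _

theorem ae_pi_boxLaw_mem_gridBox (m : ℕ) [NeZero m] :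
    ∀ᵐ p ∂(Measure.pi (boxLaw m)), ∀ c, p c ∈ gridBox m c := by
  rw [pi_boxLaw_eq]
  refine Measure.ae_smul_measure ?_ _
  filter_upwards [ae_restrict_mem (MeasurableSet.univ_pi fun c => measurableSet_gridBox m c)]
    with p hp c using hp c (Set.mem_univ c)

theorem measurePreserving_eval_pair {ι α : Type*} [Fintype ι] [DecidableEq ι]
    [MeasurableSpace α] (μ : ι → Measure α) [∀ i, IsProbabilityMeasure (μ i)] {i j : ι}
    (hij : i ≠ j) :
    MeasurePreserving (fun p : ι → α => (p i, p j)) (Measure.pi μ) ((μ i).prod (μ j)) := by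
  have hm : Measurable fun p : ι → α => (p i, p j) :=
    (measurable_pi_apply i).prodMk (measurable_pi_apply j)
  have h := measurePreserving_update_update μ i j
  refine ⟨hm, ?_⟩
  rw [← h.map_eq, Measure.map_map hm h.measurable]
  have : (fun p : ι → α => (p i, p j)) ∘ (fun q : (ι → α) × (α × α) =>
      Function.update (Function.update q.1 i q.2.1) j q.2.2) = Prod.snd := by
    ext q <;> simp [Function.update_of_ne hij]
  rw [this]
  exact measurePreserving_snd.map_eq

theorem integral_boxLaw_pair (m : ℕ) [NeZero m] (K : USq → USq → ℝ) (c d : Fin m × Fin m) :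
    ∫ p, K p.1 p.2 ∂((boxLaw m c).prod (boxLaw m d)) =
      ((m : ℝ) * m) ^ 2 * ∫ p in gridBox m c ×ˢ gridBox m d, K p.1 p.2 := by
  rw [boxLaw, boxLaw, Measure.prod_smul_left, Measure.prod_smul_right, Measure.prod_restrict,
    integral_smul_measure, integral_smul_measure, smul_eq_mul, smul_eq_mul, ← mul_assoc, sq]
  simp [Measure.volume_eq_prod]

theorem sum_setIntegral_gridBox (m : ℕ) [NeZero m] {f : USq × USq → ℝ} (hf : Integrable f) :
    ∑ c, ∑ d, ∫ p in gridBox m c ×ˢ gridBox m d, f p = ∫ p, f p := by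
  have h := integral_iUnion_fintype (μ := volume) (f := f)
    (s := fun e : (Fin m × Fin m) × (Fin m × Fin m) => gridBox m e.1 ×ˢ gridBox m e.2)
    (fun e => (measurableSet_gridBox m e.1).prod (measurableSet_gridBox m e.2))
    (fun e e' hne => Set.disjoint_left.2 fun p hp hp' => hne (by
      obtain ⟨h1, h2⟩ := Set.mem_prod.1 hp
      obtain ⟨h3, h4⟩ := Set.mem_prod.1 hp'
      rw [mem_gridBox] at h1 h2 h3 h4
      exact Prod.ext (Prod.ext (h1.1.symm.trans h3.1) (h1.2.symm.trans h3.2))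
        (Prod.ext (h2.1.symm.trans h4.1) (h2.2.symm.trans h4.2))))
    (fun e => hf.integrableOn)
  have hu : (⋃ e : (Fin m × Fin m) × (Fin m × Fin m), gridBox m e.1 ×ˢ gridBox m e.2) =
      Set.univ := by
    refine Set.eq_univ_of_forall fun p => Set.mem_iUnion.2
      ⟨((blockIdx m p.1.1, blockIdx m p.1.2), (blockIdx m p.2.1, blockIdx m p.2.2)), ?_⟩
    exact Set.mem_prod.2 ⟨mem_gridBox.2 ⟨rfl, rfl⟩, mem_gridBox.2 ⟨rfl, rfl⟩⟩
  rw [hu, setIntegral_univ, Fintype.sum_prod_type] at h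
  exact h.symm

/-- The sum of a kernel over all the pairs of distinct entries of a sample. -/
def offDiagSum {ι : Type*} [Fintype ι] [DecidableEq ι] (K : USq → USq → ℝ) (p : ι → USq) : ℝ :=
  ∑ c, ∑ d, if c = d then 0 else K (p c) (p d)

theorem offDiagSum_comp_equiv {ι κ : Type*} [Fintype ι] [DecidableEq ι] [Fintype κ]
    [DecidableEq κ] (K : USq → USq → ℝ)
    (p : ι → USq) (e : κ ≃ ι) : offDiagSum K (p ∘ e) = offDiagSum K p := by
  simp only [offDiagSum]
  rw [← Equiv.sum_comp e]
  refine Finset.sum_congr rfl fun c _ => ?_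
  rw [← Equiv.sum_comp e]
  refine Finset.sum_congr rfl fun d _ => ?_
  simp only [e.injective.eq_iff, Function.comp_apply]

theorem integral_offDiagSum_le (m : ℕ) [NeZero m] {K : USq → USq → ℝ}
    (hK : Measurable (Function.uncurry K)) (h0 : ∀ u v, 0 ≤ K u v) {C : ℝ}
    (hC : ∀ u v, K u v ≤ C) :
    Integrable (offDiagSum K) (Measure.pi (boxLaw m)) ∧
    ∫ p, offDiagSum K p ∂(Measure.pi (boxLaw m)) ≤
      ((m : ℝ) * m) ^ 2 * ∫ p : USq × USq, K p.1 p.2 := by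
  have hC0 : 0 ≤ C := (h0 ((0, 0)) ((0, 0))).trans (hC _ _)
  have hterm : ∀ c d : Fin m × Fin m, Integrable
      (fun p : Fin m × Fin m → USq => if c = d then 0 else K (p c) (p d))
      (Measure.pi (boxLaw m)) := by
    intro c d
    by_cases h : c = d
    · simp [h]
    · simp only [h, if_false]
      refine integrable_of_abs_le (C := C) (measurable_kernel_eval hK c d) fun p => ?_
      rw [abs_of_nonneg (h0 _ _)]
      exact hC _ _
  refine ⟨integrable_finsetSum _ fun c _ => integrable_finsetSum _ fun d _ => hterm c d, ?_⟩
  have hKi : Integrable fun p : USq × USq => K p.1 p.2 :=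
    integrable_of_abs_le (C := C) hK fun p => by
      rw [abs_of_nonneg (h0 _ _)]
      exact hC _ _
  simp only [offDiagSum]
  rw [integral_finsetSum _ fun c _ => integrable_finsetSum _ fun d _ => hterm c d,
    ← sum_setIntegral_gridBox m hKi, Finset.mul_sum]
  refine Finset.sum_le_sum fun c _ => ?_
  rw [integral_finsetSum _ fun d _ => hterm c d, Finset.mul_sum]
  refine Finset.sum_le_sum fun d _ => ?_
  rw [← integral_boxLaw_pair]
  by_cases h : c = d
  · simp only [h, if_true, integral_zero]
    exact integral_nonneg fun p => h0 _ _
  · simp only [h, if_false]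
    have hMP := measurePreserving_eval_pair (boxLaw m) h
    rw [← hMP.map_eq, integral_map hMP.measurable.aemeasurable]
    exact hK.aestronglyMeasurable

theorem measurePreserving_comp_equiv {ι κ α : Type*} [Fintype ι] [Fintype κ]
    [MeasurableSpace α] (μ : Measure α) [IsProbabilityMeasure μ] (e : κ ≃ ι) :
    MeasurePreserving (fun p : ι → α => p ∘ e) (Measure.pi fun _ => μ)
      (Measure.pi fun _ => μ) := by
  have hm : Measurable fun p : ι → α => p ∘ e :=
    measurable_pi_iff.2 fun i => measurable_pi_apply (e i)
  refine ⟨hm, (Measure.pi_eq fun s hs => ?_).symm⟩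
  rw [Measure.map_apply hm (MeasurableSet.univ_pi hs)]
  have : (fun p : ι → α => p ∘ e) ⁻¹' Set.univ.pi s = Set.univ.pi (s ∘ e.symm) := by
    ext p
    simp only [Set.mem_preimage, Set.mem_pi, Set.mem_univ, true_imp_iff, Function.comp_apply]
    exact ⟨fun h i => by simpa using h (e.symm i), fun h i => by simpa using h (e i)⟩
  rw [this, Measure.pi_pi]
  exact Equiv.prod_comp e.symm fun i => μ (s i)

theorem ae_fst_injective {ι : Type*} [Fintype ι] :
    ∀ᵐ p : ι → USq, Function.Injective fun i => (p i).1 := by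
  have h : ∀ i j : ι, i ≠ j → ∀ᵐ p : ι → USq, (p i).1 ≠ (p j).1 := by
    intro i j hij
    have hMP := measurePreserving_eval_pair (fun _ : ι => (volume : Measure USq)) hij
    have hd : ∀ᵐ z : UI × UI, z.1 ≠ z.2 := by
      have hs : MeasurableSet {z : UI × UI | z.1 = z.2} :=
        measurableSet_eq_fun measurable_fst measurable_snd
      have h0 : volume {z : UI × UI | z.1 = z.2} = 0 := by
        rw [Measure.volume_eq_prod, Measure.measure_prod_null hs]
        refine Filter.Eventually.of_forall fun x => ?_
        have : Prod.mk x ⁻¹' {z : UI × UI | z.1 = z.2} = {x} := by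
          ext y; simp [eq_comm]
        simp only [this]
        exact measure_singleton (μ := (volume : Measure unitInterval)) x
      filter_upwards [compl_mem_ae_iff.2 h0] with z hz using hz
    have hfst : MeasurePreserving (Prod.fst : USq → UI) volume volume := measurePreserving_fst
    exact ((hfst.prod hfst).comp hMP).quasiMeasurePreserving.ae hd
  have h' : ∀ᵐ p : ι → USq, ∀ (i j : ι) (_ : i ≠ j), (p i).1 ≠ (p j).1 := by
    simp only [ae_all_iff]
    exact h
  filter_upwards [h'] with p hp i j hij
  by_contra hne
  exact hp i j hne hij

/-- A sample with one point in each box, avoiding a given null set whatever the order of its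
entries, and whose off-diagonal sum is at most the average. -/
theorem exists_grid_sample (m : ℕ) [NeZero m] {K : USq → USq → ℝ}
    (hK : Measurable (Function.uncurry K)) (h0 : ∀ u v, 0 ≤ K u v) {C : ℝ}
    (hC : ∀ u v, K u v ≤ C) {n : ℕ} {good : (Fin n → USq) → Prop} (hgood : ∀ᵐ p, good p) :
    ∃ p : Fin m × Fin m → USq, (∀ c, p c ∈ gridBox m c) ∧
      (Function.Injective fun c => (p c).1) ∧
      (∀ e : Fin n ≃ Fin m × Fin m, good (p ∘ e)) ∧
      offDiagSum K p ≤ ((m : ℝ) * m) ^ 2 * ∫ p : USq × USq, K p.1 p.2 := by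
  have hg : ∀ᵐ p : Fin m × Fin m → USq, ∀ e : Fin n ≃ Fin m × Fin m, good (p ∘ e) := by
    rw [ae_all_iff]
    intro e
    exact (measurePreserving_comp_equiv (volume : Measure USq) e).quasiMeasurePreserving.ae hgood
  have hac := pi_boxLaw_absolutelyContinuous m
  have hinj : ∀ᵐ p ∂(Measure.pi (boxLaw m)), Function.Injective fun c => (p c).1 :=
    hac.ae_le ae_fst_injective
  have hgood' : ∀ᵐ p ∂(Measure.pi (boxLaw m)), ∀ e : Fin n ≃ Fin m × Fin m, good (p ∘ e) :=
    hac.ae_le hg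
  have hall := (ae_pi_boxLaw_mem_gridBox m).and (hinj.and hgood')
  obtain ⟨hInt, hle⟩ := integral_offDiagSum_le m hK h0 hC
  obtain ⟨p, hp, hpl⟩ := exists_notMem_null_le_integral hInt (ae_iff.1 hall)
  obtain ⟨h1, h2, h3⟩ := not_not.1 hp
  exact ⟨p, h1, h2, h3, hpl.trans hle⟩

/-! ### Graphs in the property approximating an orderon -/

theorem integrable_comp_blockIdx {n : ℕ} [NeZero n] (X : Fin n → Fin n → ℝ)
    {μ : Measure (USq × USq)} [IsFiniteMeasure μ] :
    Integrable (fun p : USq × USq => X (blockIdx n p.1.1) (blockIdx n p.2.1)) μ := by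
  refine integrable_of_abs_le (C := ∑ i, ∑ j, |X i j|) (measurable_comp_blockIdx X) fun p => ?_
  refine le_trans ?_ (Finset.single_le_sum (f := fun i => ∑ j, |X i j|)
    (fun i _ => Finset.sum_nonneg fun j _ => abs_nonneg _)
    (Finset.mem_univ (blockIdx n p.1.1)))
  exact Finset.single_le_sum (f := fun j => |X (blockIdx n p.1.1) j|)
    (fun j _ => abs_nonneg _) (Finset.mem_univ (blockIdx n p.2.1))

/-- The measure of the part of `S` lying above the `i`-th of `n` equal intervals. -/
def columnMass (n : ℕ) [NeZero n] (S : Set USq) (i : Fin n) : ℝ :=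
  ((volume.restrict S).map fun u : USq => blockIdx n u.1).real {i}

theorem columnMass_mem_Icc (n : ℕ) [NeZero n] (S : Set USq) (i : Fin n) :
    columnMass n S i ∈ Set.Icc (0 : ℝ) (1 / n) := by
  refine ⟨measureReal_nonneg, ?_⟩
  have hm : Measurable fun u : USq => blockIdx n u.1 := (measurable_blockIdx n).comp measurable_fst
  have h1 : ((volume.restrict S).map fun u : USq => blockIdx n u.1) {i} ≤ (n : ℝ≥0∞)⁻¹ := by
    rw [Measure.map_apply hm (measurableSet_singleton i)]
    refine (Measure.restrict_apply_le S _).trans (le_of_eq ?_)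
    have hfst : MeasurePreserving (Prod.fst : USq → UI) volume volume := measurePreserving_fst
    rw [← volume_preimage_blockIdx n i, ← hfst.measure_preimage
      (measurable_blockIdx n (measurableSet_singleton i)).nullMeasurableSet]
    rfl
  have hn : (n : ℝ≥0∞) ≠ 0 := by exact_mod_cast NeZero.ne n
  have h2 := ENNReal.toReal_mono (ENNReal.inv_ne_top.2 hn) h1
  rw [ENNReal.toReal_inv, ENNReal.toReal_natCast] at h2
  rw [one_div]
  exact h2

theorem setIntegral_comp_blockIdx {n : ℕ} [NeZero n] (X : Fin n → Fin n → ℝ) (S T : Set USq) :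
    ∫ p in S ×ˢ T, X (blockIdx n p.1.1) (blockIdx n p.2.1) =
      ∑ i, ∑ j, columnMass n S i * columnMass n T j * X i j := by
  have hm : Measurable fun u : USq => blockIdx n u.1 := (measurable_blockIdx n).comp measurable_fst
  have hX : Measurable fun e : Fin n × Fin n => X e.1 e.2 := measurable_of_finite _
  have h := integral_map (μ := (volume.restrict S).prod (volume.restrict T))
    (hm.prodMap hm).aemeasurable (f := fun e : Fin n × Fin n => X e.1 e.2)
    hX.aestronglyMeasurable
  rw [← Measure.map_prod_map _ _ hm hm, Measure.prod_restrict, integral_fintype .of_finite,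
    Fintype.sum_prod_type] at h
  rw [Measure.volume_eq_prod]
  refine Eq.trans h.symm ?_
  refine Finset.sum_congr rfl fun i _ => Finset.sum_congr rfl fun j _ => ?_
  rw [← Set.singleton_prod_singleton, measureReal_prod_prod, smul_eq_mul]
  rfl

theorem cutNorm_graphOrderon_sub_le {n : ℕ} [NeZero n] (F : SimpleGraph (Fin n)) (P : Fin n → USq)
    {U K : USq → USq → ℝ} (hU : IsKernel01 U) {f : USq → USq} (hf : MeasurePreserving f)
    (hK : Measurable (Function.uncurry K)) (h0 : ∀ u v, 0 ≤ K u v) {C : ℝ}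
    (hC : ∀ u v, K u v ≤ C) {ε B : ℝ} (hε : 0 ≤ ε)
    (hB : ∀ S T : Finset (Fin n),
      |∑ i ∈ S, ∑ j ∈ T, roundingError F (fun i j => U (P i) (P j)) i j| ≤ B)
    (hsum : offDiagSum K P ≤ (n : ℝ) ^ 2 * ε) (hInt : ∫ p : USq × USq, K p.1 p.2 ≤ ε)
    {good : USq → Prop} (hgood : ∀ᵐ u, good u)
    (hclose : ∀ u v, good u → good v →
      |U (P (blockIdx n u.1)) (P (blockIdx n v.1)) - U (f u) (f v)| ≤
        K (P (blockIdx n u.1)) (P (blockIdx n v.1)) + ε + K (f u) (f v)) :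
    cutNorm (fun u v => graphOrderon F u v - U (f u) (f v)) ≤
      (1 / n) ^ 2 * B + 1 / n + 3 * ε := by
  have hn : (0 : ℝ) < n := by exact_mod_cast Nat.pos_of_ne_zero (NeZero.ne n)
  have hB0 : 0 ≤ B := (abs_nonneg _).trans (hB ∅ ∅)
  set R := roundingError F (fun i j => U (P i) (P j)) with hR
  let D : Fin n → Fin n → ℝ := fun i j => if i = j then 1 else K (P i) (P j)
  have hD0 : ∀ i j, 0 ≤ D i j := fun i j => by
    simp only [D]; split_ifs <;> [exact zero_le_one; exact h0 _ _]
  have hff : MeasurePreserving (fun p : USq × USq => (f p.1, f p.2)) volume volume := hf.prod hf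
  have hW := isKernel01_graphOrderon F
  have hUf := hU.comp hf.measurable
  have hGm : Measurable fun p : USq × USq => graphOrderon F p.1 p.2 - U (f p.1) (f p.2) :=
    hW.1.sub hUf.1
  have hGi : Integrable fun p : USq × USq => graphOrderon F p.1 p.2 - U (f p.1) (f p.2) :=
    integrable_of_abs_le hGm fun p => abs_sub_le_one_of_mem (hW.2 _ _) (hUf.2 _ _)
  have hRi : Integrable fun p : USq × USq => R (blockIdx n p.1.1) (blockIdx n p.2.1) :=
    integrable_comp_blockIdx R
  have hKi : Integrable fun p : USq × USq => K p.1 p.2 :=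
    integrable_of_abs_le (C := C) hK fun p => by rw [abs_of_nonneg (h0 _ _)]; exact hC _ _
  have hKf : Integrable fun p : USq × USq => K (f p.1) (f p.2) :=
    hff.integrable_comp_of_integrable hKi
  have hDi : Integrable fun p : USq × USq => D (blockIdx n p.1.1) (blockIdx n p.2.1) :=
    integrable_comp_blockIdx D
  have hDε : Integrable fun p : USq × USq => D (blockIdx n p.1.1) (blockIdx n p.2.1) + ε :=
    hDi.add (integrable_const ε)
  have hGR : Integrable fun p : USq × USq => graphOrderon F p.1 p.2 - U (f p.1) (f p.2) -
      R (blockIdx n p.1.1) (blockIdx n p.2.1) := hGi.sub hRi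
  have hgood2 : ∀ᵐ p : USq × USq, good p.1 ∧ good p.2 := by
    have h1 : ∀ᵐ p : USq × USq, good p.1 := Measure.quasiMeasurePreserving_fst.ae hgood
    have h2 : ∀ᵐ p : USq × USq, good p.2 := Measure.quasiMeasurePreserving_snd.ae hgood
    exact h1.and h2
  have hDint : ∫ p : USq × USq, D (blockIdx n p.1.1) (blockIdx n p.2.1) ≤ 1 / n + ε := by
    rw [← setIntegral_univ, ← Set.univ_prod_univ, setIntegral_comp_blockIdx]
    have hle : ∑ i, ∑ j, columnMass n Set.univ i * columnMass n Set.univ j * D i j ≤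
        ∑ i, ∑ j, (1 / n : ℝ) ^ 2 * D i j := by
      refine Finset.sum_le_sum fun i _ => Finset.sum_le_sum fun j _ =>
        mul_le_mul_of_nonneg_right ?_ (hD0 i j)
      rw [sq]
      have hi := columnMass_mem_Icc n Set.univ i
      have hj := columnMass_mem_Icc n Set.univ j
      exact mul_le_mul hi.2 hj.2 hj.1 (by positivity)
    refine hle.trans ?_
    simp only [← Finset.mul_sum]
    have hDsum : ∑ i, ∑ j, D i j = n + offDiagSum K P := by
      have : ∀ i j, D i j = (if i = j then 1 else 0) + if i = j then 0 else K (P i) (P j) := by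
        intro i j
        simp only [D]
        split_ifs <;> simp
      simp only [this, Finset.sum_add_distrib, offDiagSum]
      simp
    rw [hDsum]
    calc (1 / n : ℝ) ^ 2 * (n + offDiagSum K P) ≤ (1 / n : ℝ) ^ 2 * (n + (n : ℝ) ^ 2 * ε) := by
          gcongr
      _ = 1 / n + ε := by field_simp
  have hrest : ∫ p : USq × USq, |graphOrderon F p.1 p.2 - U (f p.1) (f p.2) -
      R (blockIdx n p.1.1) (blockIdx n p.2.1)| ≤ 1 / n + 3 * ε := by
    have h1 : ∫ p : USq × USq, |graphOrderon F p.1 p.2 - U (f p.1) (f p.2) -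
        R (blockIdx n p.1.1) (blockIdx n p.2.1)| ≤
        ∫ p : USq × USq, (D (blockIdx n p.1.1) (blockIdx n p.2.1) + ε + K (f p.1) (f p.2)) := by
      refine integral_mono_ae hGR.abs (hDε.add hKf) ?_
      filter_upwards [hgood2] with p hp
      have hcl := hclose p.1 p.2 hp.1 hp.2
      simp only [graphOrderon_apply, hR, roundingError, D]
      by_cases hij : blockIdx n p.1.1 = blockIdx n p.2.1
      · simp only [hij, SimpleGraph.irrefl, if_true, if_false, sub_zero, zero_sub, abs_neg]
        have := hU.2 (f p.1) (f p.2)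
        rw [abs_of_nonneg this.1]
        linarith [this.2, h0 (f p.1) (f p.2)]
      · simp only [hij, if_false]
        refine le_trans (le_of_eq ?_) hcl
        congr 1
        ring
    refine h1.trans ?_
    rw [integral_add hDε hKf, integral_add hDi (integrable_const ε)]
    have h2 : ∫ p : USq × USq, K (f p.1) (f p.2) = ∫ p : USq × USq, K p.1 p.2 := by
      have h := integral_map (μ := (volume : Measure (USq × USq))) hff.measurable.aemeasurable
        (f := fun p : USq × USq => K p.1 p.2) hK.aestronglyMeasurable
      rw [hff.map_eq] at h
      exact h.symm
    rw [h2]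
    simp only [integral_const, probReal_univ, one_smul]
    linarith
  refine cutNorm_le (by positivity) fun S T hS hT => ?_
  have hsplit : ∫ p in S ×ˢ T, (graphOrderon F p.1 p.2 - U (f p.1) (f p.2)) =
      (∫ p in S ×ˢ T, R (blockIdx n p.1.1) (blockIdx n p.2.1)) +
      ∫ p in S ×ˢ T, (graphOrderon F p.1 p.2 - U (f p.1) (f p.2) -
        R (blockIdx n p.1.1) (blockIdx n p.2.1)) := by
    rw [← integral_add hRi.integrableOn hGR.integrableOn]
    congr 1
    ext p
    ring
  rw [hsplit]
  refine (abs_add_le _ _).trans ?_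
  rw [add_assoc]
  refine add_le_add ?_ ?_
  · rw [setIntegral_comp_blockIdx]
    exact abs_sum_sum_mul_le (by positivity) (columnMass_mem_Icc n S) (columnMass_mem_Icc n T) hB
  · refine (abs_integral_le_integral_abs).trans (le_trans ?_ hrest)
    exact setIntegral_le_integral hGR.abs
      (Filter.Eventually.of_forall fun p => abs_nonneg _)

/-! ### Changing an orderon of the closure where it is not rounded -/

theorem blockIdx_eq_of_lt_of_le {m : ℕ} [NeZero m] {x : UI} {i : ℕ} (hi : i < m)
    (h1 : (i : ℝ) < m * x) (h2 : (m : ℝ) * x ≤ i + 1) : blockIdx m x = ⟨i, hi⟩ := by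
  ext
  have : ⌈(m : ℝ) * x⌉₊ = i + 1 := by
    rw [Nat.ceil_eq_iff (by simp)]
    push_cast
    exact ⟨by simpa using h1, h2⟩
  simp only [blockIdx, this, Nat.add_sub_cancel]

theorem blockIdx_mono (m : ℕ) [NeZero m] : Monotone (blockIdx m) := by
  intro x y hxy
  rw [Fin.le_def]
  have hxy' : (x : ℝ) ≤ y := hxy
  have : ⌈(m : ℝ) * x⌉₊ ≤ ⌈(m : ℝ) * y⌉₊ := Nat.ceil_le_ceil (by gcongr)
  simp only [blockIdx]
  omega

theorem blockIdx_mul_self (m : ℕ) [NeZero m] (x : UI) (hx : 0 < (x : ℝ)) :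
    blockIdx (m * m) x = finProdFinEquiv (blockIdx m x, blockIdx m (blockFrac m x)) := by
  have hm : (0 : ℝ) < m := by exact_mod_cast Nat.pos_of_ne_zero (NeZero.ne m)
  have h1 := blockIdx_lt_mul m _ (blockFrac_pos m x hx)
  have h2 := (blockIdx_le_mul m (blockFrac m x)).2
  have h3 : (m : ℝ) * blockFrac m x = m * (m * x) - m * (blockIdx m x : ℕ) := by
    simp only [blockFrac]
    ring
  refine blockIdx_eq_of_lt_of_le _ ?_ ?_ <;> push_cast <;> nlinarith

theorem dist_le_of_mem_gridBox {m : ℕ} [NeZero m] {c : Fin m × Fin m} {u v : USq}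
    (hu : u ∈ gridBox m c) (hv : v ∈ gridBox m c) : dist u v ≤ 1 / m := by
  rw [mem_gridBox] at hu hv
  have key : ∀ x y : UI, blockIdx m x = blockIdx m y → dist x y ≤ 1 / m := by
    intro x y hxy
    have h := abs_blockPt_sub_le m (blockIdx m x) (blockFrac m x) (blockFrac m y)
    rw [blockPt_idx_frac, hxy, blockPt_idx_frac] at h
    exact h
  exact max_le (key _ _ (hu.1.trans hv.1.symm)) (key _ _ (hu.2.trans hv.2.symm))

theorem rearrange_mem_gridBox {m : ℕ} [NeZero m] (σ : Fin m → Equiv.Perm (Fin m)) {u : USq}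
    (hu : 0 < (u.1 : ℝ) ∧ 0 < (u.2 : ℝ)) :
    rearrange m σ u ∈ gridBox m
      (Equiv.prodCongrRight σ (finProdFinEquiv.symm (blockIdx (m * m) u.1))) := by
  rw [blockIdx_mul_self m _ hu.1, Equiv.symm_apply_apply, rearrange, if_pos hu, mem_gridBox]
  exact ⟨blockIdx_blockPt m _ _ (blockFrac_pos m _ (blockFrac_pos m _ hu.1)),
    blockIdx_blockPt m _ _ hu.2⟩

theorem exists_strictMono_grid_ordering {m : ℕ} [NeZero m] {p : Fin m × Fin m → USq}
    (hp : ∀ c, p c ∈ gridBox m c) (hinj : Function.Injective fun c => (p c).1) :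
    ∃ σ : Fin m → Equiv.Perm (Fin m), StrictMono fun i =>
      (p (Equiv.prodCongrRight σ (finProdFinEquiv.symm i))).1 := by
  refine ⟨fun a => Tuple.sort fun b => (p (a, b)).1, fun i j hij => ?_⟩
  obtain ⟨⟨a, b⟩, rfl⟩ := finProdFinEquiv.surjective i
  obtain ⟨⟨a', b'⟩, rfl⟩ := finProdFinEquiv.surjective j
  simp only [Equiv.symm_apply_apply, Equiv.prodCongrRight_apply]
  have hval : (b : ℕ) + m * a < b' + m * a' := by simpa [Fin.lt_def] using hij
  have hb := b.2
  have hb' := b'.2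
  rcases lt_trichotomy a a' with h | rfl | h
  · by_contra hcon
    have hle := blockIdx_mono m (not_lt.1 hcon)
    rw [(mem_gridBox.1 (hp _)).1, (mem_gridBox.1 (hp _)).1] at hle
    exact absurd hle (not_le.2 h)
  · have hbb : b < b' := by rw [Fin.lt_def]; omega
    refine lt_of_le_of_ne (Tuple.monotone_sort (fun b => (p (a, b)).1) hbb.le) fun heq => ?_
    have := hinj heq
    simp only [Prod.mk.injEq, true_and, EmbeddingLike.apply_eq_iff_eq] at this
    exact hbb.ne this
  · exfalso
    have h' : (a' : ℕ) + 1 ≤ a := h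
    nlinarith

theorem exists_graph_csDist_le {H : ∀ n, Set (SimpleGraph (Fin n))} (hH : Hereditary H)
    {U : USq → USq → ℝ} (hU : InClosure H U) {U' : USq → USq → ℝ} (hU' : IsOrderon U')
    (hsupp : ∀ u v, U u v = 0 ∨ U u v = 1 → U' u v = U u v) {ε : ℝ} (hε : 0 < ε) (hε1 : ε ≤ 1)
    (N : ℕ) : ∃ n ≥ N, ∃ F ∈ H n, csDist (graphOrderon F) U' ≤ 6 * ε := by
  have hU'k : IsKernel01 U' := ⟨hU'.1, hU'.2.1⟩
  have hU'i : Integrable (fun q : USq × USq => U' q.1 q.2) :=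
    integrable_of_abs_le (C := 1) hU'.1 fun q => by
      rw [abs_of_nonneg (hU'.2.1 _ _).1]
      exact (hU'.2.1 _ _).2
  obtain ⟨V, hV, -⟩ := hU'i.exists_boundedContinuous_integral_sub_le hε
  obtain ⟨δ, hδ, hVδ⟩ := Metric.uniformContinuous_iff.1
    (CompactSpace.uniformContinuous_of_continuous V.continuous) ε hε
  let K : USq → USq → ℝ := fun u v => |U' u v - V (u, v)|
  have hK : Measurable (Function.uncurry K) := (hU'.1.sub V.continuous.measurable).abs
  have hK0 : ∀ u v, 0 ≤ K u v := fun u v => abs_nonneg _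
  have hKC : ∀ u v, K u v ≤ 1 + ‖V‖ := fun u v => by
    refine (abs_sub _ _).trans (add_le_add ?_ (V.norm_coe_le_norm (u, v)))
    rw [abs_of_nonneg (hU'.2.1 _ _).1]
    exact (hU'.2.1 _ _).2
  have hKint : ∫ q : USq × USq, K q.1 q.2 ≤ ε := hV
  obtain ⟨m, hmN, hmδ, hmε, hmε2, hm0⟩ : ∃ m : ℕ, N ≤ m ∧ 1 / δ < m ∧ 1 / ε ≤ m ∧
      48 / ε ^ 2 ≤ m ∧ 0 < m := by
    have h1 := tendsto_natCast_atTop_atTop (R := ℝ)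
    exact ((eventually_ge_atTop N).and ((h1.eventually_gt_atTop (1 / δ)).and
      ((h1.eventually_ge_atTop (1 / ε)).and ((h1.eventually_ge_atTop (48 / ε ^ 2)).and
        (eventually_gt_atTop 0))))).exists
  have : NeZero m := ⟨hm0.ne'⟩
  have hmR : (0 : ℝ) < m := by exact_mod_cast hm0
  have hm1 : (1 : ℝ) ≤ m := by exact_mod_cast hm0
  rw [div_lt_iff₀ hδ] at hmδ
  rw [div_le_iff₀ hε] at hmε
  rw [div_le_iff₀ (by positivity)] at hmε2
  have hmδ' : 1 / (m : ℝ) < δ := by rw [div_lt_iff₀ hmR]; linarith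
  have hmε' : 1 / (m : ℝ) ≤ ε := by rw [div_le_iff₀ hmR]; linarith
  obtain ⟨p, hp, hinj, hgood, hsum⟩ := exists_grid_sample m hK hK0 hKC
    (ae_mem_of_supportCompat hH hU (m * m))
  obtain ⟨σ, hσ⟩ := exists_strictMono_grid_ordering hp hinj
  let e : Fin (m * m) ≃ Fin m × Fin m := finProdFinEquiv.symm.trans (Equiv.prodCongrRight σ)
  have hmono : StrictMono fun i => ((p ∘ e) i).1 := hσ
  obtain ⟨F, hF, hFB⟩ := exists_graph_roundingError_le
    (w := fun i j => U' ((p ∘ e) i) ((p ∘ e) j)) (fun i j => hU'.2.1 _ _)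
    (fun i j => hU'.2.2 _ _) (r := ε / 8) (by positivity) (by linarith)
  refine ⟨m * m, hmN.trans (Nat.le_mul_self m), F, ?_, ?_⟩
  · refine hgood e (fun i j hij => hmono hij) F fun i j hij => ?_
    obtain ⟨h1, h2⟩ := hF i j hij
    refine ⟨fun hadj h => h1 hadj ?_, fun hadj h => h2 hadj ?_⟩
    · exact (hsupp _ _ (Or.inl h)).trans h
    · exact (hsupp _ _ (Or.inr h)).trans h
  · have hcut := cutNorm_graphOrderon_sub_le F (p ∘ e) hU'k (isMPB_rearrange m σ).1 hK hK0 hKC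
      hε.le hFB (by
        rw [offDiagSum_comp_equiv]
        push_cast
        exact hsum.trans (by gcongr)) hKint ae_pos_USq (fun u v hu hv => by
        have hd : ∀ u : USq, 0 < (u.1 : ℝ) ∧ 0 < (u.2 : ℝ) →
            dist ((p ∘ e) (blockIdx (m * m) u.1)) (rearrange m σ u) < δ := fun u hu =>
          (dist_le_of_mem_gridBox (hp _) (rearrange_mem_gridBox σ hu)).trans_lt hmδ'
        set P := p ∘ e
        set f := rearrange m σ
        have h1 : |V (P (blockIdx (m * m) u.1), P (blockIdx (m * m) v.1)) - V (f u, f v)| ≤ ε :=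
          (hVδ (max_lt (hd u hu) (hd v hv))).le
        have h2 := abs_sub_comm (U' (f u) (f v)) (V (f u, f v))
        refine (abs_sub_le _ (V (f u, f v)) _).trans (add_le_add ?_ h2.ge)
        exact (abs_sub_le _ (V (P (blockIdx (m * m) u.1), P (blockIdx (m * m) v.1))) _).trans
          (add_le_add le_rfl h1))
    refine (csDist_le _ _ (isMPB_rearrange m σ)).trans ?_
    have hshift := shiftOf_rearrange_le m σ
    have hnoise : (1 / ((m * m : ℕ) : ℝ)) ^ 2 * ((1 + 2 * ((m * m : ℕ) : ℝ)) / (ε / 8) +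
        4 * (ε / 8) * ((m * m : ℕ) : ℝ) ^ 2) ≤ ε := by
      have hn : (m : ℝ) ≤ ((m * m : ℕ) : ℝ) := by exact_mod_cast Nat.le_mul_self m
      set n : ℝ := ((m * m : ℕ) : ℝ)
      have hn1 : 1 ≤ n := hm1.trans hn
      have h48 : 48 ≤ n * ε ^ 2 := hmε2.trans (by gcongr)
      rw [div_pow, one_pow, one_div_mul_eq_div, div_le_iff₀ (by positivity)]
      have h3 : (1 + 2 * n) / (ε / 8) ≤ ε * n ^ 2 / 2 := by
        rw [div_le_iff₀ (by positivity)]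
        nlinarith
      linarith
    have hinv : 1 / ((m * m : ℕ) : ℝ) ≤ ε := by
      refine le_trans ?_ hmε'
      gcongr
      exact_mod_cast Nat.le_mul_self m
    linarith

theorem InClosure.of_eq_of_eq_zero_or_one {H : ∀ n, Set (SimpleGraph (Fin n))} (hH : Hereditary H)
    {U : USq → USq → ℝ} (hU : InClosure H U) {U' : USq → USq → ℝ} (hU' : IsOrderon U')
    (hsupp : ∀ u v, U u v = 0 ∨ U u v = 1 → U' u v = U u v) : InClosure H U' := by
  have h := fun k : ℕ => exists_graph_csDist_le hH hU hU' hsupp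
    (ε := 1 / ((k : ℝ) + 1)) (by positivity)
    (by rw [div_le_one (by positivity)]; linarith [k.cast_nonneg (α := ℝ)]) k
  choose n hn F hF hd using h
  refine ⟨hU', n, F, hF, tendsto_atTop_mono hn tendsto_id, ?_⟩
  refine squeeze_zero (fun k => csDist_nonneg _ _) hd ?_
  simpa using (tendsto_one_div_add_atTop_nhds_zero_nat (𝕜 := ℝ)).const_mul 6

/-! ### Concavity -/

/-- The kernel equal to `U` where `U` takes the values `0` and `1`, and to `W` elsewhere. -/
def patchOutsideRounded (U W : USq → USq → ℝ) (u v : USq) : ℝ :=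
  if U u v = 0 ∨ U u v = 1 then U u v else W u v

theorem IsOrderon.patchOutsideRounded {U W : USq → USq → ℝ} (hU : IsOrderon U)
    (hW : IsOrderon W) : IsOrderon (patchOutsideRounded U W) := by
  refine ⟨?_, fun u v => ?_, fun u v => ?_⟩
  · have hs : MeasurableSet {q : USq × USq | U q.1 q.2 = 0 ∨ U q.1 q.2 = 1} :=
      (hU.1 (measurableSet_singleton 0)).union (hU.1 (measurableSet_singleton 1))
    exact Measurable.ite hs hU.1 hW.1
  · rw [_root_.patchOutsideRounded]
    split_ifs <;> [exact hU.2.1 _ _; exact hW.2.1 _ _]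
  · rw [_root_.patchOutsideRounded, _root_.patchOutsideRounded, hU.2.2 u v, hW.2.2 u v]

theorem mul_abs_sub_patch_add_le {t a b c : ℝ}
    (ha : a ∈ Set.Icc (0 : ℝ) 1) (hb : b ∈ Set.Icc (0 : ℝ) 1) :
    t * |a - if c = 0 ∨ c = 1 then c else a| + (1 - t) * |b - if c = 0 ∨ c = 1 then c else b| ≤
      |t * a + (1 - t) * b - c| := by
  split_ifs with h
  · rcases h with rfl | rfl
    · rw [sub_zero, sub_zero, sub_zero, abs_of_nonneg ha.1, abs_of_nonneg hb.1]
      exact le_abs_self _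
    · rw [abs_of_nonpos (by linarith [ha.2]), abs_of_nonpos (by linarith [hb.2])]
      refine le_trans (le_of_eq ?_) (neg_le_abs _)
      ring
  · simp

theorem IsOrderon.integrable_abs_sub {W U : USq → USq → ℝ} (hW : IsOrderon W)
    (hU : IsOrderon U) : Integrable fun q : USq × USq => |W q.1 q.2 - U q.1 q.2| :=
  integrable_of_abs_le (C := 1) (hW.1.sub hU.1).abs fun q => by
    rw [abs_abs]
    exact abs_sub_le_one_of_mem (hW.2.1 _ _) (hU.2.1 _ _)

theorem IsOrderon.convexCombination {W₁ W₂ : USq → USq → ℝ} (hW₁ : IsOrderon W₁)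
    (hW₂ : IsOrderon W₂) {t : ℝ} (ht : t ∈ Set.Icc (0 : ℝ) 1) :
    IsOrderon fun u v => t * W₁ u v + (1 - t) * W₂ u v := by
  refine ⟨(hW₁.1.const_mul t).add (hW₂.1.const_mul (1 - t)), fun u v => ?_, fun u v => ?_⟩
  · exact convex_Icc (0 : ℝ) 1 (hW₁.2.1 u v) (hW₂.2.1 u v) ht.1 (by linarith [ht.2]) (by ring)
  · simp only [hW₁.2.2 u v, hW₂.2.2 u v]

theorem d1ToClosure_le {H : ∀ n, Set (SimpleGraph (Fin n))} {U : USq → USq → ℝ}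
    (hU : InClosure H U) (W : USq → USq → ℝ) : d1ToClosure H W ≤ d1 W U := by
  refine csInf_le ⟨0, ?_⟩ ⟨U, hU, rfl⟩
  rintro x ⟨V, -, rfl⟩
  exact integral_nonneg fun q => abs_nonneg _

/-- The distance from the closure of a hereditary property is a concave function on
the space of orderons. -/
theorem d1_to_closure_concave
    (H : ∀ n, Set (SimpleGraph (Fin n))) (hH : Hereditary H)
    (hne : ∃ U : USq → USq → ℝ, InClosure H U)
    (W₁ W₂ : USq → USq → ℝ) (hW₁ : IsOrderon W₁) (hW₂ : IsOrderon W₂)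
    (t : ℝ) (ht : t ∈ Set.Icc (0:ℝ) 1) :
    t * d1ToClosure H W₁ + (1 - t) * d1ToClosure H W₂ ≤
      d1ToClosure H (fun u v => t * W₁ u v + (1 - t) * W₂ u v) := by
  obtain ⟨U₀, hU₀⟩ := hne
  refine le_csInf ⟨_, U₀, hU₀, rfl⟩ ?_
  rintro x ⟨U, hU, rfl⟩
  have hpatch : ∀ W, IsOrderon W → InClosure H (patchOutsideRounded U W) := fun W hW =>
    hU.of_eq_of_eq_zero_or_one hH (hU.1.patchOutsideRounded hW) fun u v h => by
      rw [patchOutsideRounded, if_pos h]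
  have ht1 : 0 ≤ 1 - t := by linarith [ht.2]
  have hi₁ := hW₁.integrable_abs_sub (hpatch W₁ hW₁).1
  have hi₂ := hW₂.integrable_abs_sub (hpatch W₂ hW₂).1
  calc t * d1ToClosure H W₁ + (1 - t) * d1ToClosure H W₂
      ≤ t * d1 W₁ (patchOutsideRounded U W₁) + (1 - t) * d1 W₂ (patchOutsideRounded U W₂) :=
        add_le_add (mul_le_mul_of_nonneg_left (d1ToClosure_le (hpatch W₁ hW₁) W₁) ht.1)
          (mul_le_mul_of_nonneg_left (d1ToClosure_le (hpatch W₂ hW₂) W₂) ht1)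
    _ = ∫ q : USq × USq, (t * |W₁ q.1 q.2 - patchOutsideRounded U W₁ q.1 q.2| +
          (1 - t) * |W₂ q.1 q.2 - patchOutsideRounded U W₂ q.1 q.2|) := by
        rw [integral_add (hi₁.const_mul t) (hi₂.const_mul (1 - t)), integral_const_mul,
          integral_const_mul, d1, d1]
    _ ≤ d1 (fun u v => t * W₁ u v + (1 - t) * W₂ u v) U :=
        integral_mono ((hi₁.const_mul t).add (hi₂.const_mul (1 - t)))
          ((hW₁.convexCombination hW₂ ht).integrable_abs_sub hU.1) fun q =>
            mul_abs_sub_patch_add_le (hW₁.2.1 _ _) (hW₂.2.1 _ _)
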